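/- arXiv:2206.09121 — 3 statements merged into one kernel-verified Lean document; each statement's English description precedes it below -/
import Mathlib

section
/- Let k be a field and f ∈ k[x_1,...,x_n] a homogeneous cubic of slice rank 3. Then dim L_f ≤ 12. -/
open MvPolynomial

/-- The slice rank of a polynomial: minimal `r` such that `f` lies in an ideal
generated by `r` linear forms. -/
noncomputable def sliceRank {k : Type*} [Field k] {σ : Type*} (f : MvPolynomial σ k) : ℕ :=
  sInf {r : ℕ | ∃ ℓ : Fin r → MvPolynomial σ k,
    (∀ i, (ℓ i).IsHomogeneous 1) ∧ f ∈ Ideal.span (Set.range ℓ)}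

/-- `P_f`: the set of subspaces of linear forms of dimension `rk f` whose ideal contains `f`. -/
def slicePlanes {k : Type*} [Field k] {σ : Type*} (f : MvPolynomial σ k) :
    Set (Submodule k (MvPolynomial σ k)) :=
  {P | P ≤ homogeneousSubmodule σ k 1 ∧ Module.finrank k P = sliceRank f ∧
    f ∈ Ideal.span (P : Set (MvPolynomial σ k))}

/-- `L_f`: the sum of all subspaces in `P_f`. -/
noncomputable def Lspace {k : Type*} [Field k] {σ : Type*} (f : MvPolynomial σ k) :
    Submodule k (MvPolynomial σ k) :=
  sSup (slicePlanes f)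

namespace SliceRank

variable {k : Type*} [Field k] {σ : Type*}

/-- The ideal generated by a subspace of polynomials, viewed as a subspace. -/
noncomputable def idealOf (P : Submodule k (MvPolynomial σ k)) : Submodule k (MvPolynomial σ k) :=
  (Ideal.span (P : Set (MvPolynomial σ k))).restrictScalars k

theorem le_idealOf (P : Submodule k (MvPolynomial σ k)) : P ≤ idealOf P :=
  fun _ h => Ideal.subset_span h

theorem idealOf_mono {P Q : Submodule k (MvPolynomial σ k)} (h : P ≤ Q) :
    idealOf P ≤ idealOf Q :=
  Ideal.span_mono h

theorem mul_mem_idealOf_left {P : Submodule k (MvPolynomial σ k)} {f : MvPolynomial σ k}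
    (hf : f ∈ idealOf P) (g : MvPolynomial σ k) : f * g ∈ idealOf P :=
  Ideal.mul_mem_right _ (Ideal.span (P : Set (MvPolynomial σ k))) hf

theorem idealOf_mul_le (P X : Submodule k (MvPolynomial σ k)) : idealOf P * X ≤ idealOf P :=
  Submodule.mul_le.2 fun _ hp x _ => mul_mem_idealOf_left hp x

theorem mul_le_idealOf (P X : Submodule k (MvPolynomial σ k)) : P * X ≤ idealOf P :=
  Submodule.mul_le.2 fun _ hp x _ => mul_mem_idealOf_left (le_idealOf P hp) x

theorem mul_le_idealOf' (P X : Submodule k (MvPolynomial σ k)) : X * P ≤ idealOf P :=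
  mul_comm X P ▸ mul_le_idealOf P X

/-- Two linear maps agreeing on the variables agree on linear forms. -/
theorem linearMap_eq_of_eq_X {M : Type*} [AddCommMonoid M] [Module k M]
    {φ ψ : MvPolynomial σ k →ₗ[k] M} (h : ∀ i, φ (X i) = ψ (X i)) {v : MvPolynomial σ k}
    (hv : v ∈ homogeneousSubmodule σ k 1) : φ v = ψ v := by
  rw [homogeneousSubmodule_one_eq_span_X] at hv
  exact LinearMap.eqOn_span (by rintro _ ⟨i, rfl⟩; exact h i) hv

/-- A substitution by linear forms whose kernel is the ideal of `P`, fixing a given complementary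
space of linear forms. -/
theorem exists_quotient_hom {P N : Submodule k (MvPolynomial σ k)}
    (hP : P ≤ homogeneousSubmodule σ k 1) (hN : N ≤ homogeneousSubmodule σ k 1)
    (hPN : Disjoint P N) :
    ∃ φ : MvPolynomial σ k →ₐ[k] MvPolynomial σ k,
      (∀ f, f ∈ idealOf P ↔ φ f = 0) ∧ (∀ f, f - φ f ∈ idealOf P) ∧ (∀ v ∈ N, φ v = v) ∧
      ∀ v ∈ homogeneousSubmodule σ k 1, v - φ v ∈ P := by
  obtain ⟨N', hNN', hc⟩ := hPN.symm.exists_isCompl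
  let π : MvPolynomial σ k →ₗ[k] MvPolynomial σ k := Submodule.projection _ _ hc
  let φ : MvPolynomial σ k →ₐ[k] MvPolynomial σ k := aeval fun i => π (X i)
  have hφ : ∀ v ∈ homogeneousSubmodule σ k 1, φ v = π v := fun v hv =>
    linearMap_eq_of_eq_X (φ := φ.toLinearMap) (fun i => by simp [φ]) hv
  have hπ : ∀ v, v - π v ∈ P := fun v => by
    rw [← Submodule.projection_apply_eq_zero_iff hc, map_sub,
      Submodule.projection_apply_of_mem_left hc (Submodule.projection_apply_mem hc v), sub_self]
  have hsub : ∀ f, f - φ f ∈ idealOf P := by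
    intro f
    have : (Ideal.Quotient.mkₐ k (Ideal.span (P : Set (MvPolynomial σ k)))).comp φ =
        Ideal.Quotient.mkₐ k _ := by
      ext i
      simp only [AlgHom.comp_apply, Ideal.Quotient.mkₐ_eq_mk]
      refine (Ideal.Quotient.eq.2 ?_).symm
      rw [hφ _ (isHomogeneous_X k i)]
      exact Ideal.subset_span (hπ _)
    exact Ideal.Quotient.eq.1 (DFunLike.congr_fun this f).symm
  refine ⟨φ, fun f => ⟨fun hf => ?_, fun h => ?_⟩, hsub, fun v hv => ?_, fun v hv => ?_⟩
  · have : Ideal.span (P : Set (MvPolynomial σ k)) ≤ RingHom.ker φ := by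
      refine Ideal.span_le.2 fun p hp => ?_
      change φ p = 0
      rw [hφ p (hP hp)]
      simpa [π] using hp
    exact this hf
  · simpa [h] using hsub f
  · rw [hφ v (hN hv)]
    exact Submodule.projection_apply_of_mem_left hc (hNN' hv)
  · rw [hφ v hv]
    exact hπ v

theorem mem_of_mem_idealOf {P : Submodule k (MvPolynomial σ k)}
    (hP : P ≤ homogeneousSubmodule σ k 1) {v : MvPolynomial σ k}
    (hv : v ∈ homogeneousSubmodule σ k 1) (h : v ∈ idealOf P) : v ∈ P := by
  obtain ⟨φ, h1, -, -, h4⟩ := exists_quotient_hom hP bot_le disjoint_bot_right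
  simpa [(h1 v).1 h] using h4 v hv

theorem mem_idealOf_or {P : Submodule k (MvPolynomial σ k)}
    (hP : P ≤ homogeneousSubmodule σ k 1) {f g : MvPolynomial σ k}
    (h : f * g ∈ idealOf P) : f ∈ idealOf P ∨ g ∈ idealOf P := by
  obtain ⟨φ, h1, -⟩ := exists_quotient_hom hP bot_le disjoint_bot_right
  simpa [h1] using h

/-- A substitution fixing the linear forms in `N` fixes all polynomials in them. -/
theorem eq_self_of_mem_pow {φ : MvPolynomial σ k →ₐ[k] MvPolynomial σ k}
    {N : Submodule k (MvPolynomial σ k)} (h : ∀ v ∈ N, φ v = v) {d : ℕ} {f : MvPolynomial σ k}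
    (hf : f ∈ N ^ d) : φ f = f := by
  suffices key : N ^ d ≤ LinearMap.eqLocus φ.toLinearMap LinearMap.id from key hf
  clear hf
  induction d with
  | zero => rintro _ ⟨c, rfl⟩; simp
  | succ d ih =>
    rw [pow_succ]
    refine Submodule.mul_le.2 fun a ha b hb => ?_
    have ha : φ a = a := ih ha
    change φ (a * b) = a * b
    rw [map_mul, ha, h b hb]

/-- Polynomials in linear forms complementary to `P` never lie in the ideal of `P`. -/
theorem eq_zero_of_mem_pow_of_mem_idealOf {P N : Submodule k (MvPolynomial σ k)}
    (hP : P ≤ homogeneousSubmodule σ k 1) (hN : N ≤ homogeneousSubmodule σ k 1)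
    (hPN : Disjoint P N) {d : ℕ} {f : MvPolynomial σ k} (hf : f ∈ N ^ d) (hfP : f ∈ idealOf P) :
    f = 0 := by
  obtain ⟨φ, h1, -, h3, -⟩ := exists_quotient_hom hP hN hPN
  rw [← (h1 f).1 hfP, eq_self_of_mem_pow h3 hf]

theorem finiteDimensional_of_le [Finite σ] {d : ℕ} {P : Submodule k (MvPolynomial σ k)}
    (hP : P ≤ homogeneousSubmodule σ k d) : FiniteDimensional k P :=
  have : FiniteDimensional k (homogeneousSubmodule σ k d) :=
    Module.Finite.iff_fg.2 (homogeneousSubmodule_fg (σ := σ) (R := k) d)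
  Submodule.finiteDimensional_of_le hP

theorem sliceRank_le_finrank [Finite σ] {P : Submodule k (MvPolynomial σ k)}
    (hP : P ≤ homogeneousSubmodule σ k 1) {f : MvPolynomial σ k} (hf : f ∈ idealOf P) :
    sliceRank f ≤ Module.finrank k P := by
  have := finiteDimensional_of_le hP
  let b := Module.finBasis k P
  refine Nat.sInf_le ⟨fun i => b i, fun i => hP (b i).2, ?_⟩
  suffices h : (P : Set (MvPolynomial σ k)) ⊆
      Ideal.span (Set.range fun i => (b i : MvPolynomial σ k))
    from Ideal.span_le.2 h hf
  intro p hp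
  have : p = ∑ i, C (b.repr ⟨p, hp⟩ i) * (b i : MvPolynomial σ k) := by
    have := congrArg (Subtype.val) (b.sum_repr ⟨p, hp⟩)
    simpa only [Submodule.coe_sum, Submodule.coe_smul, smul_eq_C_mul] using this.symm
  rw [this]
  exact Ideal.sum_mem _ fun i _ => Ideal.mul_mem_left _ _ (Ideal.subset_span ⟨i, rfl⟩)

/-- If `f` only involves the linear forms in `W` modulo the ideal of `K ≤ W`, then every member
of `P_f` containing `K` is contained in `W`. -/
theorem le_of_mem_pow_sup [Finite σ] {f : MvPolynomial σ k} {P W K : Submodule k (MvPolynomial σ k)}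
    (hP : P ∈ slicePlanes f) (hW : W ≤ homogeneousSubmodule σ k 1) (hKP : K ≤ P) (hKW : K ≤ W)
    (d : ℕ) (hf : f ∈ W ^ d ⊔ idealOf K) : P ≤ W := by
  intro v hv
  by_contra hvW
  have hvV := hP.1 hv
  have := finiteDimensional_of_le hP.1
  obtain ⟨φ, h1, h2, h3, h4⟩ := exists_quotient_hom (P := k ∙ v) (N := W)
    ((Submodule.span_singleton_le_iff_mem _ _).2 hvV) hW
    (Submodule.disjoint_span_singleton_of_notMem hvW).symm
  have hmap : P.map φ.toLinearMap ≤ homogeneousSubmodule σ k 1 := by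
    rintro _ ⟨p, hp, rfl⟩
    have := sub_mem (hP.1 hp)
      ((Submodule.span_singleton_le_iff_mem _ _).2 hvV (h4 p (hP.1 hp)))
    simpa using this
  have himage : ∀ g ∈ idealOf P, φ g ∈ idealOf (P.map φ.toLinearMap) := by
    intro g hg
    have : Ideal.span (P : Set (MvPolynomial σ k)) ≤
        (Ideal.span (P.map φ.toLinearMap : Set (MvPolynomial σ k))).comap φ :=
      Ideal.span_le.2 fun p hp => Ideal.subset_span ⟨p, hp, rfl⟩
    exact this hg
  have hK : K ≤ P.map φ.toLinearMap := fun w hw => ⟨w, hKP hw, h3 w (hKW hw)⟩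
  have hfmap : f ∈ idealOf (P.map φ.toLinearMap) := by
    obtain ⟨x, hx, y, hy, rfl⟩ := Submodule.mem_sup.1 hf
    have h5 := himage _ hP.2.2
    rw [map_add, eq_self_of_mem_pow h3 hx] at h5
    have h6 := sub_mem h5 (himage _ (idealOf_mono hKP hy))
    rw [add_sub_cancel_right] at h6
    exact add_mem h6 (idealOf_mono hK hy)
  have h5 := sliceRank_le_finrank hmap hfmap
  have h6 := LinearMap.finrank_range_add_finrank_ker (φ.toLinearMap.domRestrict P)
  rw [LinearMap.range_domRestrict, hP.2.1] at h6
  have h7 : Module.finrank k (LinearMap.ker (φ.toLinearMap.domRestrict P)) = 0 := by omega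
  rw [Submodule.finrank_eq_zero] at h7
  have h8 : (⟨v, hv⟩ : P) ∈ LinearMap.ker (φ.toLinearMap.domRestrict P) :=
    (h1 v).1 (le_idealOf _ (Submodule.mem_span_singleton_self v))
  rw [h7, Submodule.mem_bot] at h8
  exact hvW (by rw [show v = 0 from congrArg Subtype.val h8]; exact zero_mem W)

/-- Polynomials over `k[σ]` whose coefficients at monomials of degree `j` lie in `A ^ (d - j)`. -/
def coeffPow (A : Submodule k (MvPolynomial σ k)) (d : ℕ) :
    Submodule k (MvPolynomial σ (MvPolynomial σ k)) where
  carrier := {F | ∀ m, coeff m F ∈ if m.degree ≤ d then A ^ (d - m.degree) else ⊥}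
  add_mem' ha hb m := by rw [coeff_add]; exact add_mem (ha m) (hb m)
  zero_mem' m := by rw [coeff_zero]; exact zero_mem _
  smul_mem' c F hF m := by rw [coeff_smul]; exact Submodule.smul_mem _ c (hF m)

theorem mul_mem_coeffPow {A : Submodule k (MvPolynomial σ k)} {d e : ℕ}
    {F G : MvPolynomial σ (MvPolynomial σ k)} (hF : F ∈ coeffPow A d) (hG : G ∈ coeffPow A e) :
    F * G ∈ coeffPow A (d + e) := by
  classical
  intro m
  rw [coeff_mul]
  refine Submodule.sum_mem _ fun x hx => ?_
  rw [Finset.HasAntidiagonal.mem_antidiagonal] at hx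
  subst hx
  have h1 := hF x.1
  have h2 := hG x.2
  rw [map_add]
  split_ifs at h1 h2 with h3 h4
  · rw [if_pos (by omega), show d + e - (x.1.degree + x.2.degree) =
      (d - x.1.degree) + (e - x.2.degree) by omega, pow_add]
    exact Submodule.mul_mem_mul h1 h2
  all_goals simp_all

theorem exists_pow_decomposition {f : MvPolynomial σ k} {A : Submodule k (MvPolynomial σ k)}
    (hA : A ≤ homogeneousSubmodule σ k 1) (hf : f.IsHomogeneous 3)
    (F : Set (Submodule k (MvPolynomial σ k))) (hF : F.Nonempty) (hle : ∀ P ∈ F, P ≤ A)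
    (hmem : ∀ P ∈ F, f ∈ idealOf P) :
    f ∈ A ^ 3 ⊔ (A ^ 2 ⊓ ⨅ P ∈ F, idealOf P) * homogeneousSubmodule σ k 1 ⊔
      (A ⊓ ⨅ P ∈ F, idealOf P) * homogeneousSubmodule σ k 2 := by
  classical
  obtain ⟨B, hB⟩ := Submodule.exists_isCompl A
  let π : MvPolynomial σ k →ₗ[k] MvPolynomial σ k := Submodule.projection _ _ hB
  have hπA : ∀ v, π v ∈ A := fun v => Submodule.projection_apply_mem hB v
  have hπ : ∀ v ∈ A, π v = v := fun v hv => Submodule.projection_apply_of_mem_left hB hv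
  let L : MvPolynomial σ k →ₐ[k] MvPolynomial σ (MvPolynomial σ k) :=
    mapAlgHom (Algebra.ofId k (MvPolynomial σ k))
  let θ : MvPolynomial σ k →ₐ[k] MvPolynomial σ (MvPolynomial σ k) :=
    aeval fun i => C (π (X i)) + L (X i - π (X i))
  have hθ : ∀ v ∈ homogeneousSubmodule σ k 1, θ v = C (π v) + L (v - π v) := fun v hv => by
    let ι : MvPolynomial σ k →ₐ[k] MvPolynomial σ (MvPolynomial σ k) :=
      (Algebra.ofId (MvPolynomial σ k) _).restrictScalars k
    exact linearMap_eq_of_eq_X (φ := θ.toLinearMap)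
      (ψ := ι.toLinearMap ∘ₗ π + L.toLinearMap ∘ₗ (LinearMap.id - π)) (fun i => by
        simp [θ, ι, Algebra.ofId_apply, algebraMap_eq]) hv
  have hLX : ∀ g, aeval X (L g) = g := fun g => by
    have : ((aeval X : MvPolynomial σ (MvPolynomial σ k) →ₐ[MvPolynomial σ k]
        MvPolynomial σ k).restrictScalars k).comp L = AlgHom.id k _ := by
      ext1 i
      simp [L]
    exact DFunLike.congr_fun this g
  have hθX : ∀ g, aeval X (θ g) = g := by
    intro g
    have : ((aeval X : MvPolynomial σ (MvPolynomial σ k) →ₐ[MvPolynomial σ k]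
        MvPolynomial σ k).restrictScalars k).comp θ = AlgHom.id k _ := by
      ext1 i
      change aeval X (θ (X i)) = X i
      rw [show θ (X i) = _ from aeval_X _ i, map_add, hLX, ← algebraMap_eq, AlgHom.commutes]
      simp
    exact DFunLike.congr_fun this g
  have hθ1 : ∀ v ∈ homogeneousSubmodule σ k 1, θ v ∈ coeffPow A 1 := by
    intro v hv m
    have hw : (v - π v).IsHomogeneous 1 := sub_mem hv (hA (hπA v))
    have hL : coeff m (L (v - π v)) = C (coeff m (v - π v)) := coeff_map _ _ _
    rw [hθ v hv, coeff_add, coeff_C, hL]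
    by_cases h0 : m = 0
    · subst h0
      rw [hw.coeff_eq_zero (by simp)]
      simpa using hπA v
    · rw [if_neg (Ne.symm h0), zero_add]
      have h1 : m.degree ≠ 0 := (Finsupp.degree_eq_zero_iff m).not.2 h0
      split_ifs with h
      · rw [show 1 - m.degree = 0 by omega]
        exact Submodule.mem_one.2 ⟨_, rfl⟩
      · rw [hw.coeff_eq_zero (by omega), map_zero]
        exact zero_mem _
  have hθ3 : θ f ∈ coeffPow A 3 := by
    rw [← mem_homogeneousSubmodule, ← homogeneousSubmodule_one_pow] at hf
    have : ∀ d, ∀ g ∈ homogeneousSubmodule σ k 1 ^ (d + 1), θ g ∈ coeffPow A (d + 1) := by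
      intro d
      induction d with
      | zero => simpa using hθ1
      | succ d ih =>
        intro g hg
        rw [pow_succ] at hg
        induction hg using Submodule.mul_induction_on' with
        | mem_mul_mem a ha b hb =>
          rw [map_mul]; exact mul_mem_coeffPow (ih a ha) (hθ1 b hb)
        | add a _ b _ ha hb => rw [map_add]; exact add_mem ha hb
    exact this 2 f hf
  have hθP : ∀ P ∈ F, ∀ m, coeff m (θ f) ∈ idealOf P := by
    intro P hP
    refine mem_map_C_iff.1 ?_
    have : (Ideal.span (P : Set (MvPolynomial σ k))) ≤
        (Ideal.map C (Ideal.span (P : Set (MvPolynomial σ k)))).comap θ := by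
      refine Ideal.span_le.2 fun p hp => ?_
      have hpA := hle P hP hp
      change θ p ∈ Ideal.map C (Ideal.span (P : Set (MvPolynomial σ k)))
      rw [hθ p (hA hpA), hπ p hpA, sub_self, map_zero, add_zero]
      exact Ideal.mem_map_of_mem _ (Ideal.subset_span hp)
    exact this (hmem P hP)
  have hinf : ∀ m, coeff m (θ f) ∈ ⨅ P ∈ F, idealOf P := fun m => by
    simpa [Submodule.mem_iInf] using fun P hP => hθP P hP m
  rw [← hθX f, aeval_eq_eval, eval_eq]
  refine Submodule.sum_mem _ fun m _ => ?_
  have hm : ∏ i ∈ m.support, (X i : MvPolynomial σ k) ^ m i ∈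
      homogeneousSubmodule σ k m.degree := by
    have := isHomogeneous_monomial (1 : k) (rfl : m.degree = m.degree)
    rwa [monomial_eq, C_1, one_mul] at this
  have hc := hθ3 m
  split_ifs at hc with h
  · obtain h | h | h | h : m.degree = 0 ∨ m.degree = 1 ∨ m.degree = 2 ∨ m.degree = 3 := by omega
    all_goals rw [h] at hc hm
    · rw [Finsupp.degree_eq_zero_iff] at h
      subst h
      exact Submodule.mem_sup_left (Submodule.mem_sup_left (by simpa using hc))
    · exact Submodule.mem_sup_left (Submodule.mem_sup_right (Submodule.mul_mem_mul ⟨hc, hinf m⟩ hm))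
    · exact Submodule.mem_sup_right (Submodule.mul_mem_mul ⟨by simpa using hc, hinf m⟩ hm)
    · obtain ⟨P, hP⟩ := hF
      rw [eq_zero_of_mem_pow_of_mem_idealOf (d := 0) ((hle P hP).trans hA) bot_le
        disjoint_bot_right hc (hθP P hP m), zero_mul]
      exact zero_mem _
  · rw [(Submodule.mem_bot k).1 hc, zero_mul]
    exact zero_mem _

theorem exists_sum_of_mem_mul {U V : Submodule k (MvPolynomial σ k)} {n : ℕ}
    (b : Module.Basis (Fin n) k U) {x : MvPolynomial σ k} (hx : x ∈ U * V) :
    ∃ v : Fin n → MvPolynomial σ k, (∀ i, v i ∈ V) ∧ x = ∑ i, (b i : MvPolynomial σ k) * v i := by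
  induction hx using Submodule.mul_induction_on' with
  | mem_mul_mem u hu v hv =>
    refine ⟨fun i => b.repr ⟨u, hu⟩ i • v, fun i => Submodule.smul_mem _ _ hv, ?_⟩
    have := congrArg Subtype.val (b.sum_repr ⟨u, hu⟩)
    simp only [Submodule.coe_sum, Submodule.coe_smul] at this
    conv_lhs => rw [← this, Finset.sum_mul]
    simp
  | add x _ y _ hx hy =>
    obtain ⟨v, hv, rfl⟩ := hx
    obtain ⟨w, hw, rfl⟩ := hy
    exact ⟨v + w, fun i => add_mem (hv i) (hw i), by simp [mul_add, Finset.sum_add_distrib]⟩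

/-- Main estimate: if the planes of a family `F` lie in `A` and `U` accounts for all the quadrics
on `A` in all the ideals of the family, up to the ideal of `K`, then all planes through `K` lie in
a common space of dimension at most `dim A + dim U`. -/
theorem exists_container [Finite σ] {f : MvPolynomial σ k} (hf : f.IsHomogeneous 3)
    {A K U : Submodule k (MvPolynomial σ k)} (hA : A ≤ homogeneousSubmodule σ k 1) (hKA : K ≤ A)
    (hUA : U ≤ A ^ 2) (F : Set (Submodule k (MvPolynomial σ k))) (hF : F.Nonempty)
    (hle : ∀ P ∈ F, P ≤ A) (hmem : ∀ P ∈ F, P ∈ slicePlanes f)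
    (hK : ∀ v ∈ A, (∀ P ∈ F, v ∈ P) → v ∈ K)
    (hU : ∀ g ∈ A ^ 2, (∀ P ∈ F, g ∈ idealOf P) → g ∈ U ⊔ idealOf K) :
    ∃ W ≤ homogeneousSubmodule σ k 1, A ≤ W ∧
      Module.finrank k W ≤ Module.finrank k A + Module.finrank k U ∧
      ∀ P ∈ slicePlanes f, K ≤ P → P ≤ W := by
  have hA2 : A ^ 2 ≤ homogeneousSubmodule σ k 2 := by
    rw [← homogeneousSubmodule_one_pow]
    exact pow_le_pow_left' hA 2
  have := finiteDimensional_of_le hA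
  have := finiteDimensional_of_le (hUA.trans hA2)
  have hdec : f ∈ A ^ 3 ⊔ U * homogeneousSubmodule σ k 1 ⊔ idealOf K := by
    refine SetLike.le_def.1 ?_
      (exists_pow_decomposition hA hf F hF hle fun P hP => (hmem P hP).2.2)
    refine sup_le (sup_le (le_sup_of_le_left le_sup_left) ?_) ?_
    · have h : A ^ 2 ⊓ ⨅ P ∈ F, idealOf P ≤ U ⊔ idealOf K := fun g hg =>
        hU g hg.1 (by simpa [Submodule.mem_iInf] using hg.2)
      refine (mul_le_mul_left h _).trans ?_
      rw [Submodule.sup_mul]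
      exact sup_le_sup le_sup_right (idealOf_mul_le _ _)
    · have h : A ⊓ ⨅ P ∈ F, idealOf P ≤ K := fun v hv =>
        hK v hv.1 fun P hP => mem_of_mem_idealOf (hmem P hP).1 (hA hv.1)
          ((Submodule.mem_iInf _).1 ((Submodule.mem_iInf _).1 hv.2 P) hP)
      exact le_sup_of_le_right ((mul_le_mul_left h _).trans (mul_le_idealOf _ _))
  obtain ⟨z, hz, y, hy, rfl⟩ := Submodule.mem_sup.1 hdec
  obtain ⟨a, ha, u, hu, rfl⟩ := Submodule.mem_sup.1 hz
  obtain ⟨v, hv, rfl⟩ := exists_sum_of_mem_mul (Module.finBasis k U) hu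
  have hspan : Submodule.span k (Set.range v) ≤ homogeneousSubmodule σ k 1 :=
    Submodule.span_le.2 (by rintro _ ⟨i, rfl⟩; exact hv i)
  have := finiteDimensional_of_le hspan
  have hW := sup_le hA hspan
  refine ⟨A ⊔ Submodule.span k (Set.range v), hW, le_sup_left, ?_, fun P hP hKP => ?_⟩
  · refine (Submodule.finrank_add_le_finrank_add_finrank _ _).trans ?_
    gcongr
    exact (finrank_range_le_card (R := k) v).trans_eq (Fintype.card_fin _)
  · refine le_of_mem_pow_sup hP hW hKP (hKA.trans le_sup_left) 3
      (add_mem (Submodule.mem_sup_left (add_mem ?_ (Submodule.sum_mem _ fun i _ => ?_)))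
        (Submodule.mem_sup_right hy))
    · exact (show A ^ 3 ≤ _ from pow_le_pow_left' le_sup_left 3) ha
    · rw [pow_succ]
      exact Submodule.mul_mem_mul
        ((show A ^ 2 ≤ _ from pow_le_pow_left' le_sup_left 2) (hUA (Module.finBasis k U i).2))
        (Submodule.mem_sup_right (Submodule.subset_span ⟨i, rfl⟩))

theorem exists_relative_compl {P K : Submodule k (MvPolynomial σ k)} (h : K ≤ P) :
    ∃ N ≤ P, Disjoint K N ∧ K ⊔ N = P := by
  obtain ⟨D, hD⟩ := Submodule.exists_isCompl K
  refine ⟨D ⊓ P, inf_le_right, hD.disjoint.mono_right inf_le_left, ?_⟩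
  rw [← sup_inf_assoc_of_le D h, hD.sup_eq_top, top_inf_eq]

/-- Quadrics on `A` in the ideals of two subspaces `P = K ⊕ P'` and `Q = K ⊕ Q'`. -/
theorem mem_of_mem_idealOf_of_mem_idealOf {A P Q K P' Q' : Submodule k (MvPolynomial σ k)}
    (hA : A ≤ homogeneousSubmodule σ k 1) (hPA : P ≤ A) (hQA : Q ≤ A)
    (hP : K ⊔ P' = P) (hQ : K ⊔ Q' = Q) (hPQ' : Disjoint P Q') (hQP' : Disjoint Q P')
    {g : MvPolynomial σ k} (hg : g ∈ A ^ 2) (hgP : g ∈ idealOf P) (hgQ : g ∈ idealOf Q) :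
    g ∈ K * A ⊔ P' * Q' := by
  obtain ⟨C, hCA, hC, hCsup⟩ := exists_relative_compl (sup_le hPA hQA)
  have hP'P : P' ≤ P := hP ▸ le_sup_right
  have hQ'Q : Q' ≤ Q := hQ ▸ le_sup_right
  have h1 : Disjoint P (Q' ⊔ C) := hPQ'.disjoint_sup_right_of_disjoint_sup_left
    (hC.mono_left (sup_le_sup_left hQ'Q P))
  have h2 : Disjoint Q (P' ⊔ C) := hQP'.disjoint_sup_right_of_disjoint_sup_left
    (hC.mono_left (sup_comm P Q ▸ sup_le_sup_left hP'P Q))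
  have hsplit : A ^ 2 ≤ K * A ⊔ P' * Q' ⊔ P' * (P' ⊔ C) ⊔ (Q' ⊔ C) ^ 2 := by
    have hA' : A = K ⊔ (P' ⊔ (Q' ⊔ C)) := by
      rw [← hCsup, ← hP, ← hQ, ← sup_sup_distrib_left]
      simp only [sup_assoc]
    have h3 : P' * A ≤ K * A ⊔ P' * Q' ⊔ P' * (P' ⊔ C) := by
      conv_lhs => rw [hA', Submodule.mul_sup, Submodule.mul_sup, Submodule.mul_sup]
      rw [Submodule.mul_sup]
      refine sup_le ?_ (sup_le (le_sup_of_le_right le_sup_left) (sup_le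
        (le_sup_of_le_left le_sup_right) (le_sup_of_le_right le_sup_right)))
      rw [mul_comm]
      exact le_sup_of_le_left (le_sup_of_le_left (mul_le_mul_right (hP'P.trans hPA) _))
    have h4 : (Q' ⊔ C) * A ≤ K * A ⊔ P' * A ⊔ (Q' ⊔ C) ^ 2 := by
      conv_lhs => rw [hA', Submodule.mul_sup, Submodule.mul_sup, ← pow_two]
      have h5 : Q' ⊔ C ≤ A := sup_le (hQ'Q.trans hQA) hCA
      refine sup_le ?_ (sup_le ?_ le_sup_right)
      · rw [mul_comm]
        exact le_sup_of_le_left (le_sup_of_le_left (mul_le_mul_right h5 _))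
      · rw [mul_comm]
        exact le_sup_of_le_left (le_sup_of_le_right (mul_le_mul_right h5 _))
    have h5 : A ^ 2 = K * A ⊔ (P' * A ⊔ (Q' ⊔ C) * A) := by
      rw [← Submodule.sup_mul, ← Submodule.sup_mul, ← hA', pow_two]
    rw [h5]
    refine sup_le (le_sup_of_le_left (le_sup_of_le_left le_sup_left))
      (sup_le (h3.trans le_sup_left) (h4.trans (sup_le_sup_right (sup_le ?_ h3) _)))
    exact le_sup_of_le_left le_sup_left
  obtain ⟨w, hw, z, hz, rfl⟩ := Submodule.mem_sup.1 (hsplit hg)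
  obtain ⟨x, hx, y, hy, rfl⟩ := Submodule.mem_sup.1 hw
  have hxP : K * A ⊔ P' * Q' ≤ idealOf P := sup_le
    ((mul_le_idealOf _ _).trans (idealOf_mono (hP ▸ le_sup_left)))
    ((mul_le_idealOf _ _).trans (idealOf_mono hP'P))
  have hxQ : K * A ⊔ P' * Q' ≤ idealOf Q := sup_le
    ((mul_le_idealOf _ _).trans (idealOf_mono (hQ ▸ le_sup_left)))
    ((mul_le_idealOf' _ _).trans (idealOf_mono hQ'Q))
  have hz0 : z = 0 := by
    refine eq_zero_of_mem_pow_of_mem_idealOf (hPA.trans hA)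
      ((sup_le (hQ'Q.trans hQA) hCA).trans hA) h1 hz ?_
    simpa using sub_mem hgP
      (add_mem (hxP hx) (((mul_le_idealOf _ _).trans (idealOf_mono hP'P)) hy))
  have hy0 : y = 0 := by
    refine eq_zero_of_mem_pow_of_mem_idealOf (d := 2) (hQA.trans hA)
      ((sup_le (hP'P.trans hPA) hCA).trans hA) h2 ?_ ?_
    · rw [pow_two]
      exact (show P' * (P' ⊔ C) ≤ _ from mul_le_mul_left le_sup_left _) hy
    · simpa [hz0] using sub_mem hgQ (hxQ hx)
  simpa [hy0, hz0] using hx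

open Module (finrank)

theorem finrank_mul_le_mul (P Q : Submodule k (MvPolynomial σ k)) [FiniteDimensional k P]
    [FiniteDimensional k Q] : finrank k (P * Q : Submodule k (MvPolynomial σ k)) ≤
      finrank k P * finrank k Q := by
  rw [← Submodule.mulMap_range, ← Module.finrank_tensorProduct]
  exact LinearMap.finrank_range_le _

theorem finrank_sup_add_finrank_inf [Finite σ] {s t : Submodule k (MvPolynomial σ k)}
    (hs : s ≤ homogeneousSubmodule σ k 1) (ht : t ≤ homogeneousSubmodule σ k 1) :
    finrank k ↑(s ⊔ t) + finrank k ↑(s ⊓ t) = finrank k s + finrank k t :=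
  have := finiteDimensional_of_le hs
  have := finiteDimensional_of_le ht
  Submodule.finrank_sup_add_finrank_inf_eq s t

theorem finrank_le_of_le [Finite σ] {s t : Submodule k (MvPolynomial σ k)}
    (ht : t ≤ homogeneousSubmodule σ k 1) (h : s ≤ t) : finrank k s ≤ finrank k t :=
  have := finiteDimensional_of_le ht
  Submodule.finrank_mono h

theorem eq_of_le_of_finrank_le [Finite σ] {s t : Submodule k (MvPolynomial σ k)}
    (ht : t ≤ homogeneousSubmodule σ k 1) (h : s ≤ t) (h' : finrank k t ≤ finrank k s) : s = t :=
  have := finiteDimensional_of_le ht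
  Submodule.eq_of_le_of_finrank_le h h'

theorem finrank_sup_singleton [Finite σ] {s : Submodule k (MvPolynomial σ k)}
    (hs : s ≤ homogeneousSubmodule σ k 1) {v : MvPolynomial σ k}
    (hv : v ∈ homogeneousSubmodule σ k 1) (h : v ∉ s) :
    finrank k ↑(s ⊔ k ∙ v) = finrank k s + 1 := by
  have h1 := finrank_sup_add_finrank_inf hs ((Submodule.span_singleton_le_iff_mem _ _).2 hv)
  rwa [(Submodule.disjoint_span_singleton_of_notMem h).eq_bot, finrank_bot, add_zero,
    finrank_span_singleton (by rintro rfl; exact h (zero_mem s))] at h1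

/-- Multiplying by a linear form `p` outside `R` a complement of `Q ⊓ R` in `Q` gives many
quadrics outside the ideal of `R`. -/
theorem exists_disjoint_idealOf [Finite σ] {Q R : Submodule k (MvPolynomial σ k)}
    (hQ : Q ≤ homogeneousSubmodule σ k 1) (hR : R ≤ homogeneousSubmodule σ k 1)
    {p : MvPolynomial σ k} (hp : p ∈ homogeneousSubmodule σ k 1) (hpR : p ∉ R) :
    ∃ T ≤ (k ∙ p) * Q, Disjoint T (idealOf R) ∧ finrank k T + finrank k ↑(Q ⊓ R) = finrank k Q := by
  have := finiteDimensional_of_le hQ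
  obtain ⟨N, hNQ, hd, hs⟩ := exists_relative_compl (inf_le_left : Q ⊓ R ≤ Q)
  have := finiteDimensional_of_le (hNQ.trans hQ)
  have hp0 : p ≠ 0 := fun h => hpR (h ▸ zero_mem R)
  refine ⟨N.map (LinearMap.mulLeft k p), ?_, ?_, ?_⟩
  · rintro _ ⟨q, hq, rfl⟩
    exact Submodule.mul_mem_mul (Submodule.mem_span_singleton_self p) (hNQ hq)
  · rw [Submodule.disjoint_def]
    rintro _ ⟨q, hq, rfl⟩ h
    rcases mem_idealOf_or hR h with h | h
    · exact absurd (mem_of_mem_idealOf hR hp h) hpR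
    · have := mem_of_mem_idealOf hR (hQ (hNQ hq)) h
      rw [Submodule.disjoint_def.1 hd q ⟨hNQ hq, this⟩ hq, map_zero]
  · rw [← (Submodule.equivMapOfInjective _
      (show Function.Injective (LinearMap.mulLeft k p) from mul_right_injective₀ hp0) N).finrank_eq]
    have := finrank_sup_add_finrank_inf (inf_le_left.trans hQ : Q ⊓ R ≤ _) (hNQ.trans hQ)
    rw [hs, hd.eq_bot, finrank_bot] at this
    omega

theorem finrank_inf_add_le {X I J T₁ T₂ : Submodule k (MvPolynomial σ k)} [FiniteDimensional k X]
    (h₁ : T₁ ≤ X) (h₂ : T₂ ≤ X) (h₁J : T₁ ≤ J) (hIJ : I ≤ J) (h₁I : Disjoint T₁ I)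
    (h₂J : Disjoint T₂ J) :
    finrank k T₁ + finrank k T₂ + finrank k ↑(X ⊓ I) ≤ finrank k X := by
  have hd : Disjoint T₁ T₂ := (h₂J.mono_right h₁J).symm
  have hd' : Disjoint (T₁ ⊔ T₂) (X ⊓ I) :=
    ((h₁I.symm.disjoint_sup_right_of_disjoint_sup_left
      ((h₂J.mono_right (sup_le hIJ h₁J)).symm)).mono_left inf_le_right).symm
  have := Submodule.finiteDimensional_of_le h₁
  have := Submodule.finiteDimensional_of_le h₂
  have e1 := Submodule.finrank_sup_add_finrank_inf_eq T₁ T₂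
  have e2 := Submodule.finrank_sup_add_finrank_inf_eq (T₁ ⊔ T₂) (X ⊓ I)
  rw [hd.eq_bot, finrank_bot] at e1
  rw [hd'.eq_bot, finrank_bot] at e2
  have := Submodule.finrank_mono (sup_le (sup_le h₁ h₂) (inf_le_left : X ⊓ I ≤ X))
  omega

theorem finrank_Lspace_le [Finite σ] {f : MvPolynomial σ k} {W : Submodule k (MvPolynomial σ k)}
    (hW : W ≤ homogeneousSubmodule σ k 1) (h : ∀ P ∈ slicePlanes f, P ≤ W) :
    finrank k (Lspace f) ≤ finrank k W :=
  finrank_le_of_le hW (sSup_le h)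

/-- The planes through the intersection of two given planes lie in a common small space. -/
theorem exists_container_of_pair [Finite σ] {f : MvPolynomial σ k} (hf : f.IsHomogeneous 3)
    (hr : sliceRank f = 3) {P Q : Submodule k (MvPolynomial σ k)} (hP : P ∈ slicePlanes f)
    (hQ : Q ∈ slicePlanes f) :
    ∃ W ≤ homogeneousSubmodule σ k 1, P ⊔ Q ≤ W ∧
      finrank k W + finrank k ↑(P ⊓ Q) ≤ 6 + (3 - finrank k ↑(P ⊓ Q)) ^ 2 ∧
      ∀ S ∈ slicePlanes f, P ⊓ Q ≤ S → S ≤ W := by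
  have hP3 := hP.2.1.trans hr
  have hQ3 := hQ.2.1.trans hr
  have hA := sup_le hP.1 hQ.1
  obtain ⟨P', hP'P, hdP, hsP⟩ := exists_relative_compl (inf_le_left : P ⊓ Q ≤ P)
  obtain ⟨Q', hQ'Q, hdQ, hsQ⟩ := exists_relative_compl (inf_le_right : P ⊓ Q ≤ Q)
  have hKV : P ⊓ Q ≤ homogeneousSubmodule σ k 1 := inf_le_left.trans hP.1
  have := finiteDimensional_of_le (hP'P.trans hP.1)
  have := finiteDimensional_of_le (hQ'Q.trans hQ.1)
  obtain ⟨W, hW, hAW, hd, h⟩ := exists_container hf hA (K := P ⊓ Q) (U := P' * Q')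
    (inf_le_left.trans le_sup_left)
    (by rw [pow_two]; exact mul_le_mul' (hP'P.trans le_sup_left) (hQ'Q.trans le_sup_right))
    {P, Q} (by simp) (by simp) (by simp [hP, hQ]) (by simp +contextual) (by
      intro g hg hgF
      have hdP' : Disjoint P Q' := disjoint_iff.2 <| le_bot_iff.1 <| by
        rw [← hdQ.eq_bot]
        exact le_inf (le_inf inf_le_left (inf_le_right.trans hQ'Q)) inf_le_right
      have hdQ' : Disjoint Q P' := disjoint_iff.2 <| le_bot_iff.1 <| by
        rw [← hdP.eq_bot]
        exact le_inf (le_inf (inf_le_right.trans hP'P) inf_le_left) inf_le_right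
      refine SetLike.le_def.1 ?_ (mem_of_mem_idealOf_of_mem_idealOf hA le_sup_left le_sup_right
        hsP hsQ hdP' hdQ' hg (hgF P (by simp)) (hgF Q (by simp)))
      exact sup_le ((mul_le_idealOf _ _).trans le_sup_right) le_sup_left)
  refine ⟨W, hW, hAW, ?_, h⟩
  have e1 := finrank_sup_add_finrank_inf hP.1 hQ.1
  have e2 := finrank_sup_add_finrank_inf hKV (hP'P.trans hP.1)
  have e3 := finrank_sup_add_finrank_inf hKV (hQ'Q.trans hQ.1)
  rw [hsP, hdP.eq_bot, finrank_bot] at e2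
  rw [hsQ, hdQ.eq_bot, finrank_bot] at e3
  have e4 := finrank_mul_le_mul P' Q'
  rw [show finrank k P' = 3 - finrank k ↑(P ⊓ Q) by omega,
    show finrank k Q' = 3 - finrank k ↑(P ⊓ Q) by omega, ← pow_two] at e4
  omega

/-- Quadrics on `A` in the ideals of two disjoint spaces are products. -/
theorem mem_mul_of_disjoint {A P Q : Submodule k (MvPolynomial σ k)}
    (hA : A ≤ homogeneousSubmodule σ k 1) (hPA : P ≤ A) (hQA : Q ≤ A) (hPQ : Disjoint P Q)
    {g : MvPolynomial σ k} (hg : g ∈ A ^ 2) (hgP : g ∈ idealOf P) (hgQ : g ∈ idealOf Q) :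
    g ∈ P * Q := by
  simpa using mem_of_mem_idealOf_of_mem_idealOf (K := ⊥) hA hPA hQA (bot_sup_eq _)
    (bot_sup_eq _) hPQ hPQ.symm hg hgP hgQ

theorem finrank_Lspace_le_of_disjoint [Finite σ] {f : MvPolynomial σ k} (hf : f.IsHomogeneous 3)
    (hr : sliceRank f = 3) {P Q R : Submodule k (MvPolynomial σ k)} (hP : P ∈ slicePlanes f)
    (hQ : Q ∈ slicePlanes f) (hR : R ∈ slicePlanes f) (hPQ : Disjoint P Q)
    (h₁ : finrank k ↑(Q ⊓ R) ≤ finrank k ↑(P ⊓ R)) (h₂ : finrank k ↑(P ⊓ R) ≤ 1) :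
    finrank k (Lspace f) ≤ 12 := by
  have hP3 := hP.2.1.trans hr
  have hQ3 := hQ.2.1.trans hr
  have hR3 := hR.2.1.trans hr
  have hB := sup_le hP.1 hQ.1
  have hA := sup_le hB hR.1
  have := finiteDimensional_of_le hP.1
  have := finiteDimensional_of_le hQ.1
  have hPR : ¬ P ≤ R := fun h => by rw [inf_eq_left.2 h] at h₂; omega
  obtain ⟨p, hpP, hpR⟩ := SetLike.not_le_iff_exists.1 hPR
  have hpV := hP.1 hpP
  have hspan : (k ∙ p) ≤ P := (Submodule.span_singleton_le_iff_mem _ _).2 hpP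
  have hJ : R ⊔ (k ∙ p) ≤ homogeneousSubmodule σ k 1 := sup_le hR.1 (hspan.trans hP.1)
  have hRp := finrank_sup_singleton hR.1 hpV hpR
  have hPR' : ¬ P ≤ R ⊔ k ∙ p := fun h => by
    have e : P ⊓ R ⊔ k ∙ p = P := by
      rw [sup_comm, inf_comm, ← sup_inf_assoc_of_le R hspan, sup_comm]
      exact inf_eq_right.2 h
    have e' := finrank_sup_singleton (inf_le_left.trans hP.1 : P ⊓ R ≤ _) hpV
      fun h => hpR h.2
    rw [e] at e'
    omega
  obtain ⟨p', hp'P, hp'R⟩ := SetLike.not_le_iff_exists.1 hPR'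
  obtain ⟨T₁, hT₁, hd₁, e₁⟩ := exists_disjoint_idealOf hQ.1 hR.1 hpV hpR
  obtain ⟨T₂, hT₂, hd₂, e₂⟩ := exists_disjoint_idealOf hQ.1 hJ (hP.1 hp'P) hp'R
  have hspan' : (k ∙ p') ≤ P := (Submodule.span_singleton_le_iff_mem _ _).2 hp'P
  have key : finrank k ↑(Q ⊓ (R ⊔ k ∙ p)) + finrank k ↑(P ⊓ R) ≤ finrank k ↑((P ⊔ Q) ⊓ R) := by
    have hpQ : p ∉ Q := fun h => hpR (by
      rw [Submodule.disjoint_def.1 hPQ p hpP h]; exact zero_mem R)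
    have hQp := finrank_sup_singleton hQ.1 hpV hpQ
    have a1 := finrank_sup_add_finrank_inf hQ.1 hJ
    have a2 := finrank_sup_add_finrank_inf hR.1 (sup_le hQ.1 (hspan.trans hP.1))
    rw [show R ⊔ (Q ⊔ k ∙ p) = Q ⊔ (R ⊔ k ∙ p) from sup_left_comm _ _ _] at a2
    have hd : Disjoint (R ⊓ (Q ⊔ k ∙ p)) (P ⊓ R) := by
      rw [disjoint_iff, ← le_bot_iff,
        ← (Submodule.disjoint_span_singleton_of_notMem hpR).eq_bot]
      refine le_inf (inf_le_left.trans inf_le_left) ?_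
      have e : (Q ⊔ k ∙ p) ⊓ P = k ∙ p := by
        rw [sup_comm, sup_inf_assoc_of_le Q hspan, hPQ.symm.eq_bot, sup_bot_eq]
      exact (inf_le_inf inf_le_right inf_le_left).trans_eq e
    have a3 := finrank_sup_add_finrank_inf (inf_le_left.trans hR.1 : R ⊓ (Q ⊔ k ∙ p) ≤ _)
      (inf_le_left.trans hP.1 : P ⊓ R ≤ _)
    rw [hd.eq_bot, finrank_bot] at a3
    have a4 := finrank_le_of_le (inf_le_left.trans hB : (P ⊔ Q) ⊓ R ≤ _)
      (sup_le (le_inf (inf_le_right.trans (sup_le le_sup_right (hspan.trans le_sup_left)))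
        inf_le_left) (inf_le_inf_right R le_sup_left) :
        R ⊓ (Q ⊔ k ∙ p) ⊔ P ⊓ R ≤ (P ⊔ Q) ⊓ R)
    omega
  have : FiniteDimensional k (P * Q : Submodule k (MvPolynomial σ k)) :=
    finiteDimensional_of_le (d := 2) ((mul_le_mul' hP.1 hQ.1).trans (homogeneousSubmodule_mul 1 1))
  have e₃ := finrank_inf_add_le (X := P * Q) (I := idealOf R) (J := idealOf (R ⊔ k ∙ p))
    (hT₁.trans (mul_le_mul_left hspan _)) (hT₂.trans (mul_le_mul_left hspan' _))
    (hT₁.trans ((mul_le_idealOf _ _).trans (idealOf_mono le_sup_right)))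
    (idealOf_mono le_sup_left) hd₁ hd₂
  have e₄ := finrank_mul_le_mul P Q
  have e₅ := finrank_sup_add_finrank_inf hP.1 hQ.1
  have e₆ := finrank_sup_add_finrank_inf hB hR.1
  rw [hPQ.eq_bot, finrank_bot] at e₅
  rw [hP3, hQ3] at e₄
  obtain ⟨W, hW, hAW, hd, h⟩ := exists_container hf hA (K := ⊥) (U := P * Q ⊓ idealOf R) bot_le
    (by
      rw [pow_two]
      exact inf_le_left.trans (mul_le_mul' (le_sup_left.trans le_sup_left)
        (le_sup_right.trans le_sup_left)))
    {P, Q, R} (by simp) (by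
      simp only [Set.mem_insert_iff, Set.mem_singleton_iff, forall_eq_or_imp, forall_eq]
      exact ⟨le_sup_left.trans le_sup_left, le_sup_right.trans le_sup_left, le_sup_right⟩)
    (by simp [hP, hQ, hR])
    (fun v _ hv => Submodule.disjoint_def.1 hPQ v (hv P (by simp)) (hv Q (by simp)))
    (fun g hg hgF => Submodule.mem_sup_left ⟨mem_mul_of_disjoint hA
      (le_sup_left.trans le_sup_left) (le_sup_right.trans le_sup_left) hPQ hg
      (hgF P (by simp)) (hgF Q (by simp)), hgF R (by simp)⟩)
  have := finrank_Lspace_le hW fun S hS => h S hS bot_le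
  omega

theorem finrank_Lspace_le_of_disjoint_of_two_le [Finite σ] {f : MvPolynomial σ k}
    (hf : f.IsHomogeneous 3) (hr : sliceRank f = 3) {P Q R : Submodule k (MvPolynomial σ k)}
    (hP : P ∈ slicePlanes f) (hQ : Q ∈ slicePlanes f) (hR : R ∈ slicePlanes f)
    (hPQ : Disjoint P Q) (hPR : 2 ≤ finrank k ↑(P ⊓ R)) (hRB : ¬ R ≤ P ⊔ Q)
    (hS : ∀ S ∈ slicePlanes f, 2 ≤ finrank k ↑(P ⊓ S) ∨ 2 ≤ finrank k ↑(Q ⊓ S)) :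
    finrank k (Lspace f) ≤ 12 := by
  have hP3 := hP.2.1.trans hr
  have hQ3 := hQ.2.1.trans hr
  have hR3 := hR.2.1.trans hr
  have hB := sup_le hP.1 hQ.1
  have hA := sup_le hB hR.1
  have := finiteDimensional_of_le hP.1
  have := finiteDimensional_of_le hQ.1
  have : FiniteDimensional k (P * Q : Submodule k (MvPolynomial σ k)) :=
    finiteDimensional_of_le (d := 2) ((mul_le_mul' hP.1 hQ.1).trans (homogeneousSubmodule_mul 1 1))
  have hPA : P ≤ P ⊔ Q ⊔ R := le_sup_left.trans le_sup_left
  have hQA : Q ≤ P ⊔ Q ⊔ R := le_sup_right.trans le_sup_left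
  have hRA : R ≤ P ⊔ Q ⊔ R := le_sup_right
  have hKP : P ⊓ R ≤ P := inf_le_left
  have a1 := finrank_sup_add_finrank_inf hP.1 hQ.1
  have a2 := finrank_sup_add_finrank_inf hB hR.1
  rw [hPQ.eq_bot, finrank_bot] at a1
  have hlt {S T : Submodule k (MvPolynomial σ k)} (hS : S ∈ slicePlanes f) (h : ¬ S ≤ T) :
      finrank k ↑(T ⊓ S) ≤ 2 := by
    by_contra! h'
    have := eq_of_le_of_finrank_le hS.1 (inf_le_right : T ⊓ S ≤ S)
      (by rw [hS.2.1, hr]; omega)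
    exact h (this ▸ inf_le_left)
  have a3 := hlt hR hRB
  have hinf : P ⊓ R ≤ (P ⊔ Q) ⊓ R := inf_le_inf_right R le_sup_left
  have a4 := finrank_le_of_le (inf_le_left.trans hB : (P ⊔ Q) ⊓ R ≤ _) hinf
  have hKe : P ⊓ R = (P ⊔ Q) ⊓ R :=
    eq_of_le_of_finrank_le (inf_le_left.trans hB) hinf (by omega)
  have hQR : Q ⊓ R = ⊥ := le_bot_iff.1 <| hPQ
    ((inf_le_inf_right R le_sup_right).trans (hKe.ge.trans hKP)) inf_le_left
  have hPR' : ¬ P ≤ R := fun h => hRB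
    (eq_of_le_of_finrank_le hR.1 h (by omega) ▸ le_sup_left)
  obtain ⟨p, hpP, hpR⟩ := SetLike.not_le_iff_exists.1 hPR'
  have hspan : (k ∙ p) ≤ P := (Submodule.span_singleton_le_iff_mem _ _).2 hpP
  have hPe : P ⊓ R ⊔ k ∙ p = P := by
    refine eq_of_le_of_finrank_le hP.1 (sup_le hKP hspan) ?_
    rw [finrank_sup_singleton (hKP.trans hP.1) (hP.1 hpP) fun h => hpR h.2]
    omega
  obtain ⟨W, hW, hAW, hd, h⟩ := exists_container hf hA (K := P ⊓ R) (U := ⊥) (hKP.trans hPA)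
    bot_le {P, Q, R} (by simp)
    (by
      simp only [Set.mem_insert_iff, Set.mem_singleton_iff, forall_eq_or_imp, forall_eq]
      exact ⟨hPA, hQA, hRA⟩)
    (by simp [hP, hQ, hR]) (fun v _ hv => ⟨hv P (by simp), hv R (by simp)⟩)
    (by
      intro g hg hgF
      refine Submodule.mem_sup_right ?_
      have hgPQ := mem_mul_of_disjoint hA hPA hQA hPQ hg (hgF P (by simp)) (hgF Q (by simp))
      rw [← hPe, Submodule.sup_mul] at hgPQ
      obtain ⟨x, hx, y, hy, rfl⟩ := Submodule.mem_sup.1 hgPQ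
      have hx := mul_le_idealOf _ _ hx
      obtain ⟨q, hq, rfl⟩ := Submodule.mem_span_singleton_mul.1 hy
      have hy' : p * q ∈ idealOf R := by
        simpa using sub_mem (hgF R (by simp)) (idealOf_mono inf_le_right hx)
      rcases mem_idealOf_or hR.1 hy' with h | h
      · exact absurd (mem_of_mem_idealOf hR.1 (hP.1 hpP) h) hpR
      · have : q ∈ Q ⊓ R := ⟨hq, mem_of_mem_idealOf hR.1 (hQ.1 hq) h⟩
        rw [hQR, Submodule.mem_bot] at this
        simpa [this] using hx)
  rw [finrank_bot, add_zero] at hd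
  have hWA := eq_of_le_of_finrank_le hW hAW hd
  rw [← hWA] at h
  by_cases hall : ∀ S ∈ slicePlanes f, S ≤ P ⊔ Q ⊔ R
  · have := finrank_Lspace_le hA hall
    omega
  push Not at hall
  obtain ⟨S, hSf, hSA⟩ := hall
  have hS3 := hSf.2.1.trans hr
  have hKS : ¬ P ⊓ R ≤ S := fun h' => hSA (h S hSf h')
  have hA' := sup_le hA hSf.1
  have b1 := hlt hSf hSA
  have b2 : 2 ≤ finrank k ↑((P ⊔ Q ⊔ R) ⊓ S) := by
    have hAS : (P ⊔ Q ⊔ R) ⊓ S ≤ homogeneousSubmodule σ k 1 := inf_le_left.trans hA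
    exact (hS S hSf).elim (fun h => h.trans (finrank_le_of_le hAS (inf_le_inf_right S hPA)))
      fun h => h.trans (finrank_le_of_le hAS (inf_le_inf_right S hQA))
  have b3 := finrank_sup_add_finrank_inf hA hSf.1
  obtain ⟨T₁, hT₁, hd₁, e₁⟩ := exists_disjoint_idealOf hQ.1 hR.1 (hP.1 hpP) hpR
  rw [hQR, finrank_bot] at e₁
  obtain ⟨T₂, hT₂, hT₂X, hd₂, e₂⟩ : ∃ T₂ ≤ idealOf (P ⊓ R), T₂ ≤ P * Q ∧
      Disjoint T₂ (idealOf S) ∧ 2 ≤ finrank k T₂ := by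
    by_cases hQS : finrank k ↑(Q ⊓ S) ≤ 1
    · obtain ⟨r, hrK, hrS⟩ := SetLike.not_le_iff_exists.1 hKS
      obtain ⟨T₂, hT₂, hd₂, e₂⟩ := exists_disjoint_idealOf hQ.1 hSf.1 (hP.1 hrK.1) hrS
      have hspan' : (k ∙ r) ≤ P ⊓ R := (Submodule.span_singleton_le_iff_mem _ _).2 hrK
      exact ⟨T₂, hT₂.trans ((mul_le_idealOf _ _).trans (idealOf_mono hspan')),
        hT₂.trans (mul_le_mul_left (hspan'.trans hKP) _), hd₂, by omega⟩
    · have hQS' : ¬ Q ≤ S := fun h => hSA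
        (eq_of_le_of_finrank_le hSf.1 h (by omega) ▸ hQA)
      obtain ⟨q, hqQ, hqS⟩ := SetLike.not_le_iff_exists.1 hQS'
      obtain ⟨T₂, hT₂, hd₂, e₂⟩ := exists_disjoint_idealOf (hKP.trans hP.1) hSf.1 (hQ.1 hqQ) hqS
      have hQSe : Q ⊓ S = (P ⊔ Q ⊔ R) ⊓ S :=
        eq_of_le_of_finrank_le (inf_le_left.trans hA) (inf_le_inf_right S hQA) (by omega)
      have hbot : P ⊓ R ⊓ S = ⊥ := le_bot_iff.1 <| hPQ (inf_le_left.trans hKP)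
        ((inf_le_inf_right S (hKP.trans hPA)).trans (hQSe.ge.trans inf_le_left))
      rw [hbot, finrank_bot] at e₂
      have hspan' : (k ∙ q) ≤ Q := (Submodule.span_singleton_le_iff_mem _ _).2 hqQ
      refine ⟨T₂, hT₂.trans (mul_le_idealOf' _ _), hT₂.trans ?_, hd₂, by omega⟩
      rw [mul_comm]
      exact mul_le_mul' hKP hspan'
  have e₃ := finrank_inf_add_le (X := P * Q) (I := idealOf R ⊓ idealOf S) (J := idealOf R)
    hT₂X (hT₁.trans (mul_le_mul_left hspan _)) (hT₂.trans (idealOf_mono inf_le_right))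
    inf_le_left (hd₂.mono_right inf_le_right) hd₁
  have e₄ := finrank_mul_le_mul P Q
  rw [hP3, hQ3] at e₄
  have hPA' := hPA.trans (le_sup_left : _ ≤ P ⊔ Q ⊔ R ⊔ S)
  have hQA' := hQA.trans (le_sup_left : _ ≤ P ⊔ Q ⊔ R ⊔ S)
  obtain ⟨W', hW', -, hd', h'⟩ := exists_container hf hA' (K := ⊥)
    (U := P * Q ⊓ (idealOf R ⊓ idealOf S)) bot_le
    (by rw [pow_two]; exact inf_le_left.trans (mul_le_mul' hPA' hQA'))
    {P, Q, R, S} (by simp) (by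
      simp only [Set.mem_insert_iff, Set.mem_singleton_iff, forall_eq_or_imp, forall_eq]
      exact ⟨hPA', hQA', hRA.trans le_sup_left, le_sup_right⟩)
    (by simp [hP, hQ, hR, hSf])
    (fun v _ hv => Submodule.disjoint_def.1 hPQ v (hv P (by simp)) (hv Q (by simp)))
    (fun g hg hgF => Submodule.mem_sup_left ⟨mem_mul_of_disjoint hA' hPA' hQA' hPQ hg
      (hgF P (by simp)) (hgF Q (by simp)), hgF R (by simp), hgF S (by simp)⟩)
  have := finrank_Lspace_le hW' fun S hS => h' S hS bot_le
  omega

theorem finrank_Lspace_le_of_finrank_inf_eq_one [Finite σ] {f : MvPolynomial σ k}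
    (hf : f.IsHomogeneous 3) (hr : sliceRank f = 3) {P Q R : Submodule k (MvPolynomial σ k)}
    (hP : P ∈ slicePlanes f) (hQ : Q ∈ slicePlanes f) (hR : R ∈ slicePlanes f)
    (hPQ : finrank k ↑(P ⊓ Q) = 1) (hPQR : ¬ P ⊓ Q ≤ R) (hPR : ¬ Disjoint P R)
    (hQR : ¬ Disjoint Q R) : finrank k (Lspace f) ≤ 12 := by
  have hP3 := hP.2.1.trans hr
  have hQ3 := hQ.2.1.trans hr
  have hR3 := hR.2.1.trans hr
  have hB := sup_le hP.1 hQ.1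
  have hA := sup_le hB hR.1
  have hKV : P ⊓ Q ≤ homogeneousSubmodule σ k 1 := inf_le_left.trans hP.1
  have hPA : P ≤ P ⊔ Q ⊔ R := le_sup_left.trans le_sup_left
  have hQA : Q ≤ P ⊔ Q ⊔ R := le_sup_right.trans le_sup_left
  have hRA : R ≤ P ⊔ Q ⊔ R := le_sup_right
  have := finiteDimensional_of_le hP.1
  have := finiteDimensional_of_le hQ.1
  have := finiteDimensional_of_le hKV
  have := finiteDimensional_of_le hA
  have hpos {S : Submodule k (MvPolynomial σ k)} (hS : S ≤ homogeneousSubmodule σ k 1)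
      (h : S ≠ ⊥) : 1 ≤ finrank k S :=
    have := finiteDimensional_of_le hS
    Submodule.one_le_finrank_iff.2 h
  obtain ⟨l, hlK, hlR⟩ := SetLike.not_le_iff_exists.1 hPQR
  have hlV := hKV hlK
  have hspan : (k ∙ l) ≤ P ⊓ Q := (Submodule.span_singleton_le_iff_mem _ _).2 hlK
  have hlbot := Submodule.disjoint_span_singleton_of_notMem hlR
  have hKl : (k ∙ l) = P ⊓ Q := by
    refine eq_of_le_of_finrank_le hKV hspan ?_
    rw [hPQ, finrank_span_singleton (by rintro rfl; exact hlR (zero_mem R))]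
  have hKR : P ⊓ Q ⊓ R = ⊥ := by rw [← hKl, inf_comm]; exact hlbot.eq_bot
  have a1 := finrank_sup_add_finrank_inf hP.1 hQ.1
  have a2 := finrank_sup_add_finrank_inf hB hR.1
  have a3 : 2 ≤ finrank k ↑((P ⊔ Q) ⊓ R) := by
    have b1 := finrank_sup_add_finrank_inf (inf_le_left.trans hP.1 : P ⊓ R ≤ _)
      (inf_le_left.trans hQ.1 : Q ⊓ R ≤ _)
    rw [← inf_inf_distrib_right, hKR, finrank_bot] at b1
    have b2 := finrank_le_of_le (inf_le_left.trans hB : (P ⊔ Q) ⊓ R ≤ _)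
      (sup_le (inf_le_inf_right R le_sup_left) (inf_le_inf_right R le_sup_right) :
        P ⊓ R ⊔ Q ⊓ R ≤ _)
    have b3 := hpos (inf_le_left.trans hP.1) (mt disjoint_iff.2 hPR)
    have b4 := hpos (inf_le_left.trans hQ.1) (mt disjoint_iff.2 hQR)
    omega
  obtain ⟨P', hP'P, hdP, hsP⟩ := exists_relative_compl (inf_le_left : P ⊓ Q ≤ P)
  obtain ⟨Q', hQ'Q, hdQ, hsQ⟩ := exists_relative_compl (inf_le_right : P ⊓ Q ≤ Q)
  have := finiteDimensional_of_le (hP'P.trans hP.1)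
  have := finiteDimensional_of_le (hQ'Q.trans hQ.1)
  have hdP' : Disjoint P Q' := disjoint_iff.2 <| le_bot_iff.1 <| by
    rw [← hdQ.eq_bot]
    exact le_inf (le_inf inf_le_left (inf_le_right.trans hQ'Q)) inf_le_right
  have hdQ' : Disjoint Q P' := disjoint_iff.2 <| le_bot_iff.1 <| by
    rw [← hdP.eq_bot]
    exact le_inf (le_inf (inf_le_right.trans hP'P) inf_le_left) inf_le_right
  have e2 := finrank_sup_add_finrank_inf hKV (hP'P.trans hP.1)
  have e3 := finrank_sup_add_finrank_inf hKV (hQ'Q.trans hQ.1)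
  rw [hsP, hdP.eq_bot, finrank_bot] at e2
  rw [hsQ, hdQ.eq_bot, finrank_bot] at e3
  have e4 := finrank_mul_le_mul P' Q'
  have e5 := finrank_mul_le_mul (P ⊓ Q) (P ⊔ Q ⊔ R)
  rw [show finrank k P' = 2 by omega, show finrank k Q' = 2 by omega] at e4
  rw [hPQ, one_mul] at e5
  have hXA : (P ⊓ Q) * (P ⊔ Q ⊔ R) ⊔ P' * Q' ≤ (P ⊔ Q ⊔ R) ^ 2 := by
    rw [pow_two]
    exact sup_le (mul_le_mul_left (inf_le_left.trans hPA) _)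
      (mul_le_mul' (hP'P.trans hPA) (hQ'Q.trans hQA))
  have hA2 : (P ⊔ Q ⊔ R) ^ 2 ≤ homogeneousSubmodule σ k 2 := by
    rw [← homogeneousSubmodule_one_pow]
    exact pow_le_pow_left' hA 2
  set X := (P ⊓ Q) * (P ⊔ Q ⊔ R) ⊔ P' * Q' with hX
  have := finiteDimensional_of_le (hXA.trans hA2)
  have := finiteDimensional_of_le ((le_sup_left.trans hXA).trans hA2)
  have := finiteDimensional_of_le ((le_sup_right.trans hXA).trans hA2)
  have e6 := Submodule.finrank_add_le_finrank_add_finrank ((P ⊓ Q) * (P ⊔ Q ⊔ R)) (P' * Q')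
  rw [← hX] at e6
  have hJ : R ⊔ k ∙ l ≤ homogeneousSubmodule σ k 1 := sup_le hR.1 (hspan.trans hKV)
  obtain ⟨T₁, hT₁, hd₁, e₁⟩ := exists_disjoint_idealOf hA hR.1 hlV hlR
  rw [inf_eq_right.2 hRA, hR3] at e₁
  obtain ⟨T₂, hT₂, hd₂, e₂⟩ : ∃ T₂ ≤ X, Disjoint T₂ (idealOf (R ⊔ k ∙ l)) ∧
      finrank k ↑(P ⊔ Q ⊔ R) ≤ 5 + finrank k T₂ := by
    by_cases h5 : finrank k ↑(P ⊔ Q ⊔ R) ≤ 5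
    · exact ⟨⊥, bot_le, disjoint_bot_left, by omega⟩
    have hP'J : ¬ P' ≤ R ⊔ k ∙ l := fun h => h5 <| by
      have c1 := finrank_sup_add_finrank_inf hQ.1 hR.1
      have c2 := hpos (inf_le_left.trans hQ.1) (mt disjoint_iff.2 hQR)
      have c3 : P ⊔ Q ⊔ R ≤ Q ⊔ R := by
        refine sup_le (sup_le ?_ le_sup_left) le_sup_right
        rw [← hsP]
        exact sup_le (inf_le_right.trans le_sup_left)
          (h.trans (sup_le le_sup_right ((hspan.trans inf_le_right).trans le_sup_left)))
      have c4 := finrank_le_of_le (sup_le hQ.1 hR.1) c3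
      omega
    have hQ'J : ¬ Q' ≤ R ⊔ k ∙ l := fun h => h5 <| by
      have c1 := finrank_sup_add_finrank_inf hP.1 hR.1
      have c2 := hpos (inf_le_left.trans hP.1) (mt disjoint_iff.2 hPR)
      have c3 : P ⊔ Q ⊔ R ≤ P ⊔ R := by
        refine sup_le (sup_le le_sup_left ?_) le_sup_right
        rw [← hsQ]
        exact sup_le (inf_le_left.trans le_sup_left)
          (h.trans (sup_le le_sup_right ((hspan.trans inf_le_left).trans le_sup_left)))
      have c4 := finrank_le_of_le (sup_le hP.1 hR.1) c3
      omega
    obtain ⟨p, hpP, hpJ⟩ := SetLike.not_le_iff_exists.1 hP'J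
    obtain ⟨q, hqQ, hqJ⟩ := SetLike.not_le_iff_exists.1 hQ'J
    have hpq : p * q ∉ idealOf (R ⊔ k ∙ l) := fun h => (mem_idealOf_or hJ h).elim
      (fun h => hpJ (mem_of_mem_idealOf hJ (hP.1 (hP'P hpP)) h))
      fun h => hqJ (mem_of_mem_idealOf hJ (hQ.1 (hQ'Q hqQ)) h)
    refine ⟨k ∙ (p * q), ?_, (Submodule.disjoint_span_singleton_of_notMem hpq).symm, ?_⟩
    · exact (Submodule.span_singleton_le_iff_mem _ _).2
        (Submodule.mem_sup_right (Submodule.mul_mem_mul hpP hqQ))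
    · rw [finrank_span_singleton (by intro h0; exact hpq (h0 ▸ zero_mem _))]
      omega
  have e₃ := finrank_inf_add_le (X := X) (I := idealOf R) (J := idealOf (R ⊔ k ∙ l))
    (hT₁.trans ((mul_le_mul_left hspan _).trans le_sup_left)) hT₂
    (hT₁.trans ((mul_le_idealOf _ _).trans (idealOf_mono le_sup_right)))
    (idealOf_mono le_sup_left) hd₁ hd₂
  obtain ⟨W, hW, -, hd, h⟩ := exists_container hf hA (K := ⊥) (U := X ⊓ idealOf R) bot_le
    (inf_le_left.trans hXA) {P, Q, R} (by simp)
    (by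
      simp only [Set.mem_insert_iff, Set.mem_singleton_iff, forall_eq_or_imp, forall_eq]
      exact ⟨hPA, hQA, hRA⟩)
    (by simp [hP, hQ, hR])
    (fun v _ hv => hKR.le ⟨⟨hv P (by simp), hv Q (by simp)⟩, hv R (by simp)⟩)
    (fun g hg hgF => Submodule.mem_sup_left ⟨mem_of_mem_idealOf_of_mem_idealOf hA hPA hQA hsP hsQ
      hdP' hdQ' hg (hgF P (by simp)) (hgF Q (by simp)), hgF R (by simp)⟩)
  have := finrank_Lspace_le hW fun S hS => h S hS bot_le
  omega

theorem finrank_Lspace_le_twelve [Finite σ] {f : MvPolynomial σ k} (hf : f.IsHomogeneous 3)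
    (hr : sliceRank f = 3) : finrank k (Lspace f) ≤ 12 := by
  have h3 {P} (hP : P ∈ slicePlanes f) : finrank k P = 3 := hP.2.1.trans hr
  by_cases hdis : ∃ P ∈ slicePlanes f, ∃ Q ∈ slicePlanes f, Disjoint P Q
  · obtain ⟨P, hP, Q, hQ, hPQ⟩ := hdis
    by_cases hS : ∀ S ∈ slicePlanes f, 2 ≤ finrank k ↑(P ⊓ S) ∨ 2 ≤ finrank k ↑(Q ⊓ S)
    · by_cases hall : ∀ S ∈ slicePlanes f, S ≤ P ⊔ Q
      · have h1 := finrank_Lspace_le (sup_le hP.1 hQ.1) hall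
        have h2 := finrank_sup_add_finrank_inf hP.1 hQ.1
        have := h3 hP
        have := h3 hQ
        omega
      · push Not at hall
        obtain ⟨R, hR, hRB⟩ := hall
        rcases hS R hR with h | h
        · exact finrank_Lspace_le_of_disjoint_of_two_le hf hr hP hQ hR hPQ h hRB hS
        · exact finrank_Lspace_le_of_disjoint_of_two_le hf hr hQ hP hR hPQ.symm h
            (sup_comm P Q ▸ hRB) fun S hSf => (hS S hSf).symm
    · push Not at hS
      obtain ⟨R, hR, h1, h2⟩ := hS
      rcases le_total (finrank k ↑(Q ⊓ R)) (finrank k ↑(P ⊓ R)) with h | h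
      · exact finrank_Lspace_le_of_disjoint hf hr hP hQ hR hPQ h (by omega)
      · exact finrank_Lspace_le_of_disjoint hf hr hQ hP hR hPQ.symm h (by omega)
  push Not at hdis
  have hpos {P Q} (hP : P ∈ slicePlanes f) (hQ : Q ∈ slicePlanes f) :
      1 ≤ finrank k ↑(P ⊓ Q) :=
    have := finiteDimensional_of_le (inf_le_left.trans hP.1 : P ⊓ Q ≤ _)
    Submodule.one_le_finrank_iff.2 (mt disjoint_iff.2 (hdis P hP Q hQ))
  by_cases hone : ∃ P ∈ slicePlanes f, ∃ Q ∈ slicePlanes f, finrank k ↑(P ⊓ Q) = 1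
  · obtain ⟨P, hP, Q, hQ, hPQ⟩ := hone
    by_cases hall : ∀ S ∈ slicePlanes f, P ⊓ Q ≤ S
    · obtain ⟨W, hW, -, hd, h⟩ := exists_container_of_pair hf hr hP hQ
      rw [hPQ] at hd
      have := finrank_Lspace_le hW fun S hS => h S hS (hall S hS)
      omega
    · push Not at hall
      obtain ⟨R, hR, hPQR⟩ := hall
      exact finrank_Lspace_le_of_finrank_inf_eq_one hf hr hP hQ hR hPQ hPQR
        (hdis P hP R hR) (hdis Q hQ R hR)
  push Not at hone
  by_cases htwo : ∃ P ∈ slicePlanes f, ∃ Q ∈ slicePlanes f, finrank k ↑(P ⊓ Q) = 2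
  · obtain ⟨P, hP, Q, hQ, hPQ⟩ := htwo
    obtain ⟨W, hW, hPQW, hd, h⟩ := exists_container_of_pair hf hr hP hQ
    rw [hPQ] at hd
    suffices key : ∀ S ∈ slicePlanes f, S ≤ W by
      have := finrank_Lspace_le hW key
      omega
    intro S hS
    by_contra hSW
    have hSB : ¬ S ≤ P ⊔ Q := fun h' => hSW (h'.trans hPQW)
    have hB : (P ⊔ Q) ⊓ S ≤ homogeneousSubmodule σ k 1 := inf_le_right.trans hS.1
    have h1 : finrank k ↑((P ⊔ Q) ⊓ S) ≤ 2 := by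
      by_contra! h'
      exact hSB ((eq_of_le_of_finrank_le hS.1 (inf_le_right : (P ⊔ Q) ⊓ S ≤ S)
        (by rw [h3 hS]; omega)).ge.trans inf_le_left)
    have h2 := hpos hP hS
    have h2' := hone P hP S hS
    have h4 := hpos hQ hS
    have h4' := hone Q hQ S hS
    have hPS := eq_of_le_of_finrank_le hB (inf_le_inf_right S le_sup_left : P ⊓ S ≤ _) (by omega)
    have hQS := eq_of_le_of_finrank_le hB (inf_le_inf_right S le_sup_right : Q ⊓ S ≤ _) (by omega)
    have hle : P ⊓ S ≤ P ⊓ Q := le_inf inf_le_left ((hPS.trans hQS.symm).le.trans inf_le_left)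
    have heq := eq_of_le_of_finrank_le (inf_le_left.trans hP.1) hle (by omega)
    exact hSW (h S hS (heq.ge.trans inf_le_right))
  push Not at htwo
  rcases (slicePlanes f).eq_empty_or_nonempty with hempty | ⟨P, hP⟩
  · rw [Lspace, hempty, sSup_empty, finrank_bot]
    omega
  · refine (finrank_Lspace_le hP.1 fun S hS => ?_).trans (by rw [h3 hP]; omega)
    have h1 := hpos hP hS
    have h2 := hone P hP S hS
    have h4 := htwo P hP S hS
    exact (eq_of_le_of_finrank_le hS.1 (inf_le_right : P ⊓ S ≤ S)
      (by rw [h3 hS]; omega)).ge.trans inf_le_left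

end SliceRank

/-- For any homogeneous cubic `f` of slice rank `3`, `dim L_f ≤ 12`. -/
theorem dim_Lspace_le_twelve_of_sliceRank_three
    {k : Type*} [Field k] {n : ℕ}
    (f : MvPolynomial (Fin n) k) (hf : f.IsHomogeneous 3) (hr : sliceRank f = 3) :
    Module.finrank k (Lspace f) ≤ 12 := by
  exact SliceRank.finrank_Lspace_le_twelve hf hr
end

section
/- Let k be a field. There exists a homogeneous cubic f of slice rank 3 (namely f_4 = Σ_{1 ≤ i < j ≤ 4} x_i x_j y_{ij} in k[x_1,...,x_4, y_{ij} : 1 ≤ i < j ≤ 4]) with dim L_f = 10. Combined with the upper bound dim L_g ≤ 12 for every cubic g of slice rank 3, this gives 10 ≤ c(3) ≤ 12, where c(3) is the supremum of dim L_g over homogeneous cubics g of slice rank 3. -/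
open MvPolynomial

/-- The variables `x_1, …, x_4` together with `y_{ij}` for `1 ≤ i < j ≤ 4`. -/
abbrev TestVars4 := Fin 4 ⊕ {p : Fin 4 × Fin 4 // p.1 < p.2}

/-- The cubic `f_4 = Σ_{1 ≤ i < j ≤ 4} x_i x_j y_{ij}`. -/
noncomputable def testCubic4 (k : Type*) [Field k] : MvPolynomial TestVars4 k :=
  ∑ p : {p : Fin 4 × Fin 4 // p.1 < p.2},
    X (Sum.inl p.1.1) * X (Sum.inl p.1.2) * X (Sum.inr p)

open Module

section LinearAlgebra

variable {k V : Type*} [Field k] [AddCommGroup V] [Module k V]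

theorem Submodule.exists_span_range_eq (P : Submodule k V) [FiniteDimensional k P] {n : ℕ}
    (h : finrank k P = n) : ∃ a : Fin n → V, Submodule.span k (Set.range a) = P := by
  refine ⟨fun i => (finBasisOfFinrankEq k P h i : V), ?_⟩
  have := congrArg (Submodule.map P.subtype) (finBasisOfFinrankEq k P h).span_eq
  rwa [Submodule.map_span, ← Set.range_comp, Submodule.map_subtype_top] at this

theorem Submodule.finrank_map₂_le {E F : Type*} [AddCommGroup E] [Module k E] [AddCommGroup F]
    [Module k F] (l : E →ₗ[k] F →ₗ[k] V) (A : Submodule k E) (B : Submodule k F)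
    [FiniteDimensional k A] [FiniteDimensional k B] :
    finrank k (Submodule.map₂ l A B) ≤ finrank k A * finrank k B := by
  obtain ⟨a, hA⟩ := Submodule.exists_span_range_eq A rfl
  obtain ⟨b, hB⟩ := Submodule.exists_span_range_eq B rfl
  have h : Submodule.map₂ l A B = Submodule.span k (Set.range
      fun p : Fin (finrank k A) × Fin (finrank k B) =>
        l (a p.1) (b p.2)) := by
    conv_lhs => rw [← hA, ← hB]
    rw [Submodule.map₂_span_span]
    congr 1
    ext x
    simp [Set.mem_image2]
  rw [h]
  refine (finrank_range_le_card _).trans ?_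
  simp

theorem Submodule.finrank_sup_map₂_top_add_le {E F : Type*} [AddCommGroup E] [Module k E]
    [AddCommGroup F] [Module k F] [FiniteDimensional k E] [FiniteDimensional k F]
    (l : E →ₗ[k] F →ₗ[k] V) (A : Submodule k E) (B : Submodule k F) (X : Submodule k V)
    [FiniteDimensional k X] (h : Submodule.map₂ l A B ≤ X) :
    finrank k (X ⊔ Submodule.map₂ l ⊤ ⊤ : Submodule k V) + finrank k A * finrank k B ≤
      finrank k X + finrank k E * finrank k F := by
  obtain ⟨A', hA⟩ := Submodule.exists_isCompl A
  obtain ⟨B', hB⟩ := Submodule.exists_isCompl B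
  have hle : X ⊔ Submodule.map₂ l ⊤ ⊤ ≤
      X ⊔ (Submodule.map₂ l A B' ⊔ Submodule.map₂ l A' ⊤) := by
    refine sup_le le_sup_left ?_
    conv_lhs => rw [← hA.sup_eq_top, Submodule.map₂_sup_left]
    refine sup_le ?_ (le_sup_right.trans le_sup_right)
    rw [← hB.sup_eq_top, Submodule.map₂_sup_right]
    exact sup_le (h.trans le_sup_left) (le_sup_left.trans le_sup_right)
  have i1 : FiniteDimensional k (Submodule.map₂ l A B') :=
    Module.Finite.of_fg (Submodule.FG.map₂ l (Module.Finite.fg_top.of_le le_top)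
      (Module.Finite.fg_top.of_le le_top))
  have i2 : FiniteDimensional k (Submodule.map₂ l A' ⊤) :=
    Module.Finite.of_fg (Submodule.FG.map₂ l (Module.Finite.fg_top.of_le le_top)
      Module.Finite.fg_top)
  have h1 := Submodule.finrank_mono hle
  have h2 := Submodule.finrank_add_le_finrank_add_finrank X
    (Submodule.map₂ l A B' ⊔ Submodule.map₂ l A' ⊤)
  have h3 := Submodule.finrank_add_le_finrank_add_finrank
    (Submodule.map₂ l A B') (Submodule.map₂ l A' ⊤)
  have h4 := Submodule.finrank_map₂_le l A B'
  have h5 := Submodule.finrank_map₂_le l A' ⊤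
  have h6 := Submodule.finrank_add_eq_of_isCompl hA
  have h7 := Submodule.finrank_add_eq_of_isCompl hB
  rw [finrank_top] at h5
  rw [← h7] at h5
  rw [← h6, ← h7]
  nlinarith

theorem Submodule.finrank_sup_map₂_top_le_of_le {E F : Type*} [AddCommGroup E] [Module k E]
    [AddCommGroup F] [Module k F] [FiniteDimensional k E] [FiniteDimensional k F]
    (l : E →ₗ[k] F →ₗ[k] V) (A : Submodule k E) (B : Submodule k F) (X : Submodule k V)
    [FiniteDimensional k X] (hA : Submodule.map₂ l A ⊤ ≤ X) (hB : Submodule.map₂ l ⊤ B ≤ X) :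
    finrank k (X ⊔ Submodule.map₂ l ⊤ ⊤ : Submodule k V) ≤
      finrank k X + (finrank k E - finrank k A) * (finrank k F - finrank k B) := by
  obtain ⟨A', hA'⟩ := Submodule.exists_isCompl A
  obtain ⟨B', hB'⟩ := Submodule.exists_isCompl B
  have hle : X ⊔ Submodule.map₂ l ⊤ ⊤ ≤ X ⊔ Submodule.map₂ l A' B' := by
    refine sup_le le_sup_left ?_
    conv_lhs => rw [← hA'.sup_eq_top, Submodule.map₂_sup_left]
    refine sup_le (hA.trans le_sup_left) ?_
    rw [← hB'.sup_eq_top, Submodule.map₂_sup_right]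
    exact sup_le (((Submodule.map₂_le_map₂_left le_top).trans hB).trans le_sup_left) le_sup_right
  have i1 : FiniteDimensional k (Submodule.map₂ l A' B') :=
    Module.Finite.of_fg (Submodule.FG.map₂ l (Module.Finite.fg_top.of_le le_top)
      (Module.Finite.fg_top.of_le le_top))
  have h1 := Submodule.finrank_mono hle
  have h2 := Submodule.finrank_add_le_finrank_add_finrank X (Submodule.map₂ l A' B')
  have h4 := Submodule.finrank_map₂_le l A' B'
  have h6 := Submodule.finrank_add_eq_of_isCompl hA'
  have h7 := Submodule.finrank_add_eq_of_isCompl hB'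
  rw [show finrank k E - finrank k A = finrank k A' by omega,
    show finrank k F - finrank k B = finrank k B' by omega]
  omega

/-- The values taken on a finite family by the functionals killing `X`. -/
noncomputable def evalAnnihilator {ι : Type*} (X : Submodule k V) (b : ι → V) :
    Submodule k (ι → k) :=
  X.dualAnnihilator.map (LinearMap.pi fun i => Dual.eval k V (b i))

theorem mem_evalAnnihilator {ι : Type*} {X : Submodule k V} {b : ι → V} {c : ι → k} :
    c ∈ evalAnnihilator X b ↔ ∃ η : Dual k V, (∀ x ∈ X, η x = 0) ∧ ∀ i, η (b i) = c i := by
  simp only [evalAnnihilator, Submodule.mem_map, Submodule.mem_dualAnnihilator]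
  refine exists_congr fun η => and_congr_right fun _ => ?_
  rw [funext_iff]
  rfl

theorem finrank_sup_span_le_add_finrank_evalAnnihilator {ι : Type*} [Finite ι]
    (X : Submodule k V) (b : ι → V) [FiniteDimensional k X] :
    finrank k (X ⊔ Submodule.span k (Set.range b) : Submodule k V) ≤
      finrank k X + finrank k (evalAnnihilator X b) := by
  obtain ⟨κ, a, ha, hsp, hli⟩ := exists_linearIndependent' k (X.mkQ ∘ b)
  have : Finite κ := Finite.of_injective a ha
  have := Fintype.ofFinite κ
  have hle : X ⊔ Submodule.span k (Set.range b) ≤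
      X ⊔ Submodule.span k (Set.range (b ∘ a)) := by
    rw [sup_le_iff]
    refine ⟨le_sup_left, ?_⟩
    have h : (Submodule.span k (Set.range b)).map X.mkQ ≤
        (Submodule.span k (Set.range (b ∘ a))).map X.mkQ := by
      rw [Submodule.map_span, Submodule.map_span, ← Set.range_comp, ← Set.range_comp, ← hsp]
      rfl
    rw [Submodule.map_le_iff_le_comap, Submodule.comap_map_mkQ] at h
    exact h
  have := FiniteDimensional.span_of_finite k (Set.finite_range (b ∘ a))
  have h1 := Submodule.finrank_mono hle
  have h2 := Submodule.finrank_add_le_finrank_add_finrank X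
    (Submodule.span k (Set.range (b ∘ a)))
  have h3 : finrank k (Submodule.span k (Set.range (b ∘ a))) ≤ Fintype.card κ :=
    finrank_range_le_card _
  have h4 : Fintype.card κ ≤ finrank k (evalAnnihilator X b) := by
    have hsurj : (evalAnnihilator X b).map (LinearMap.funLeft k k a) = ⊤ := by
      rw [eq_top_iff]
      rintro c -
      obtain ⟨g, hg⟩ := LinearMap.exists_leftInverse_of_injective
        (Finsupp.linearCombination k ((X.mkQ ∘ b) ∘ a)) (LinearMap.ker_eq_bot.2 hli)
      refine ⟨fun i => Finsupp.linearCombination k c (g (X.mkQ (b i))), ?_, ?_⟩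
      · refine mem_evalAnnihilator.2 ⟨Finsupp.linearCombination k c ∘ₗ g ∘ₗ X.mkQ, ?_, ?_⟩
        · intro x hx
          simp [(Submodule.Quotient.mk_eq_zero X).2 hx]
        · simp
      · ext i
        have := LinearMap.congr_fun hg (Finsupp.single i 1)
        simp only [LinearMap.comp_apply, Finsupp.linearCombination_single, one_smul,
          Function.comp_apply, LinearMap.id_apply] at this
        simp only [LinearMap.funLeft_apply, this]
        simp
    have := Submodule.finrank_map_le (LinearMap.funLeft k k a) (evalAnnihilator X b)
    rwa [hsurj, finrank_top, finrank_fintype_fun_eq_card] at this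
  omega

theorem exists_dual_eq_of_finrank {ι : Type*} [Fintype ι] (X : Submodule k V) (b : ι → V)
    [FiniteDimensional k X]
    (h : finrank k X + Fintype.card ι ≤
      finrank k (X ⊔ Submodule.span k (Set.range b) : Submodule k V)) (c : ι → k) :
    ∃ η : Dual k V, (∀ x ∈ X, η x = 0) ∧ ∀ i, η (b i) = c i := by
  have h1 := finrank_sup_span_le_add_finrank_evalAnnihilator X b
  have h2 : evalAnnihilator X b = ⊤ := by
    apply Submodule.eq_top_of_finrank_eq
    have := Submodule.finrank_le (evalAnnihilator X b)
    rw [finrank_fintype_fun_eq_card] at *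
    omega
  rw [← mem_evalAnnihilator, h2]
  trivial

end LinearAlgebra

section LinearForms

variable {k σ : Type*} [Field k]

/-- A substitution of linear forms that kills `P` and fixes the linear forms of `Q`. -/
theorem exists_algHom_of_disjoint {P Q : Submodule k (MvPolynomial σ k)}
    (hP : P ≤ homogeneousSubmodule σ k 1) (h : Disjoint P Q) :
    ∃ φ : MvPolynomial σ k →ₐ[k] MvPolynomial σ k,
      (∀ p ∈ P, φ p = 0) ∧ (∀ q ∈ Q, q ∈ homogeneousSubmodule σ k 1 → φ q = q) ∧
      (∀ r, r - φ r ∈ Ideal.span (P : Set (MvPolynomial σ k))) ∧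
      ∀ n r, r.IsHomogeneous n → (φ r).IsHomogeneous n := by
  obtain ⟨Q', hQ, hc⟩ := h.symm.exists_isCompl
  set π := Q'.projection P hc with hπ
  have hsub : ∀ x, x - π x ∈ P := fun x => Submodule.sub_projection_mem hc x
  have hhom : ∀ v ∈ homogeneousSubmodule σ k 1, π v ∈ homogeneousSubmodule σ k 1 := by
    intro v hv
    have := Submodule.sub_mem _ hv (hP (hsub v))
    rwa [sub_sub_cancel] at this
  set φ : MvPolynomial σ k →ₐ[k] MvPolynomial σ k := aeval fun i => π (X i) with hφ
  have hlin : ∀ v ∈ homogeneousSubmodule σ k 1, φ v = π v := by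
    intro v hv
    rw [homogeneousSubmodule_one_eq_span_X] at hv
    induction hv using Submodule.span_induction with
    | mem x hx =>
      obtain ⟨i, rfl⟩ := hx
      simp [hφ]
    | zero => simp
    | add x y _ _ hx hy => rw [map_add, map_add, hx, hy]
    | smul c x _ hx => rw [map_smul, map_smul, hx]
  refine ⟨φ, ?_, ?_, ?_, ?_⟩
  · intro p hp
    rw [hlin p (hP hp), hπ, Submodule.projection_apply_eq_zero_iff]
    exact hp
  · intro q hq hq1
    rw [hlin q hq1]
    exact Submodule.projection_apply_left hc ⟨q, hQ hq⟩
  · intro r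
    have : (Ideal.Quotient.mkₐ k (Ideal.span (P : Set (MvPolynomial σ k)))).comp φ =
        Ideal.Quotient.mkₐ k (Ideal.span (P : Set (MvPolynomial σ k))) := by
      apply MvPolynomial.algHom_ext
      intro i
      simp only [AlgHom.comp_apply, Ideal.Quotient.mkₐ_eq_mk, hφ, aeval_X]
      refine (Ideal.Quotient.eq.2 (Ideal.subset_span ?_)).symm
      exact hsub (X i)
    have := AlgHom.congr_fun this r
    simp only [AlgHom.comp_apply, Ideal.Quotient.mkₐ_eq_mk] at this
    exact Ideal.Quotient.eq.1 this.symm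
  · intro n r hr
    have := hr.aeval (fun i => π (X i)) (n := 1) fun i => hhom _ (isHomogeneous_X k i)
    rwa [one_mul] at this

theorem algHom_eq_zero_of_mem_span {A B : Type*} [CommRing A] [CommRing B] [Algebra k A]
    [Algebra k B] {φ : A →ₐ[k] B} {s : Set A} (h : ∀ x ∈ s, φ x = 0) {r : A}
    (hr : r ∈ Ideal.span s) : φ r = 0 := by
  have : Ideal.span s ≤ RingHom.ker φ := Ideal.span_le.2 h
  exact this hr

theorem exists_sum_mul_of_mem_span_range {ι : Type*} [Fintype ι] {n : ℕ}
    {v : ι → MvPolynomial σ k} (hv : ∀ i, (v i).IsHomogeneous 1) {f : MvPolynomial σ k}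
    (hf : f.IsHomogeneous (n + 1)) (h : f ∈ Ideal.span (Set.range v)) :
    ∃ q : ι → MvPolynomial σ k, (∀ i, (q i).IsHomogeneous n) ∧ f = ∑ i, v i * q i := by
  obtain ⟨c, hc⟩ := Ideal.mem_span_range_iff_exists_fun.1 h
  refine ⟨fun i => homogeneousComponent n (c i),
    fun i => homogeneousComponent_isHomogeneous n (c i), ?_⟩
  let := MvPolynomial.gradedAlgebra (σ := σ) (R := k)
  have key : ∀ i, homogeneousComponent (n + 1) (c i * v i) =
      v i * homogeneousComponent n (c i) := by
    intro i
    have := DirectSum.coe_decompose_mul_of_right_mem_of_le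
      (homogeneousSubmodule σ k) (a := c i) (hv i) (n := n + 1) (by omega)
    rw [Nat.add_sub_cancel] at this
    rw [mul_comm (v i)]
    exact ((decomposition.decompose'_apply _ _).symm.trans this).trans
      (congrArg (· * v i) (decomposition.decompose'_apply _ _))
  rw [← homogeneousComponent_eq_self hf, ← hc, map_sum]
  exact Finset.sum_congr rfl fun i _ => key i

theorem Ideal.span_coe_span_eq (s : Set (MvPolynomial σ k)) :
    Ideal.span (Submodule.span k s : Set (MvPolynomial σ k)) = Ideal.span s :=
  Submodule.span_span_of_tower k (MvPolynomial σ k) s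

theorem mem_span_inf_of_mem_adjoin {P U : Submodule k (MvPolynomial σ k)}
    (hP : P ≤ homogeneousSubmodule σ k 1) (hU : U ≤ homogeneousSubmodule σ k 1)
    {g : MvPolynomial σ k} (hg : g ∈ Algebra.adjoin k (U : Set (MvPolynomial σ k)))
    (hgP : g ∈ Ideal.span (P : Set (MvPolynomial σ k))) :
    g ∈ Ideal.span ((P ⊓ U : Submodule k (MvPolynomial σ k)) : Set (MvPolynomial σ k)) := by
  obtain ⟨C, hC⟩ := exists_isCompl (P ⊓ U)
  have hdisj : Disjoint P (C ⊓ U) := by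
    rw [disjoint_iff, ← inf_assoc, inf_right_comm]
    exact hC.inf_eq_bot
  have hUeq : ∀ u ∈ U, ∃ p ∈ P ⊓ U, ∃ c ∈ C ⊓ U, p + c = u := by
    intro u hu
    obtain ⟨p, hp, c, hc, rfl⟩ := Submodule.mem_sup.1
      (hC.sup_eq_top ▸ Submodule.mem_top : u ∈ P ⊓ U ⊔ C)
    refine ⟨p, hp, c, ⟨hc, ?_⟩, rfl⟩
    simpa using U.sub_mem hu hp.2
  obtain ⟨φ, hφP, hφC, -, -⟩ := exists_algHom_of_disjoint hP hdisj
  set J := Ideal.span ((P ⊓ U : Submodule k (MvPolynomial σ k)) : Set (MvPolynomial σ k))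
  have hφg := algHom_eq_zero_of_mem_span hφP hgP
  have key : ∀ x ∈ Algebra.adjoin k (U : Set (MvPolynomial σ k)), x - φ x ∈ J := by
    intro x hx
    induction hx using Algebra.adjoin_induction with
    | mem u hu =>
      obtain ⟨p, hp, c, hc, rfl⟩ := hUeq u hu
      rw [map_add, hφP p hp.1, hφC c hc (hU hc.2), zero_add, add_sub_cancel_right]
      exact Ideal.subset_span hp
    | algebraMap r => simp
    | add x y _ _ hx hy =>
      rw [map_add, add_sub_add_comm]
      exact J.add_mem hx hy
    | mul x y _ _ hx hy =>
      rw [map_mul, show x * y - φ x * φ y = y * (x - φ x) + φ x * (y - φ y) by ring]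
      exact J.add_mem (J.mul_mem_left _ hx) (J.mul_mem_left _ hy)
  simpa [hφg] using key g hg

/-- A form in the ideals of `(d, a)` and of `(d, b)` lies in the ideal of the `d i` and the
products `a i * b j`, provided these linear forms are in general position. -/
theorem exists_eq_sum_add_sum_of_mem_span {δ ι κ : Type*} [Fintype δ] [Fintype ι] [Fintype κ]
    {d : δ → MvPolynomial σ k} {a : ι → MvPolynomial σ k} {b : κ → MvPolynomial σ k}
    (hd : ∀ i, (d i).IsHomogeneous 1) (ha : ∀ i, (a i).IsHomogeneous 1)
    (hb : ∀ i, (b i).IsHomogeneous 1)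
    (hdis : Disjoint (Submodule.span k (Set.range d) ⊔ Submodule.span k (Set.range a))
      (Submodule.span k (Set.range b)))
    {n : ℕ} {f : MvPolynomial σ k} (hf : f.IsHomogeneous (n + 2))
    (hfa : f ∈ Ideal.span ((Submodule.span k (Set.range d) ⊔ Submodule.span k (Set.range a) :
      Submodule k (MvPolynomial σ k)) : Set (MvPolynomial σ k)))
    (hfb : f ∈ Ideal.span ((Submodule.span k (Set.range d) ⊔ Submodule.span k (Set.range b) :
      Submodule k (MvPolynomial σ k)) : Set (MvPolynomial σ k))) :
    ∃ (q : δ → MvPolynomial σ k) (l : ι → κ → MvPolynomial σ k),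
      (∀ i, (q i).IsHomogeneous (n + 1)) ∧ (∀ i j, (l i j).IsHomogeneous n) ∧
      f = ∑ i, d i * q i + ∑ i, ∑ j, a i * b j * l i j := by
  have hle : Submodule.span k (Set.range d) ⊔ Submodule.span k (Set.range a) ≤
      homogeneousSubmodule σ k 1 := by
    rw [sup_le_iff, Submodule.span_le, Submodule.span_le]
    exact ⟨Set.range_subset_iff.2 hd, Set.range_subset_iff.2 ha⟩
  obtain ⟨φ, hφ0, hφb, hφs, hφh⟩ := exists_algHom_of_disjoint hle hdis
  have hφf := algHom_eq_zero_of_mem_span hφ0 hfa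
  rw [← Submodule.span_union, ← Set.Sum.elim_range, Ideal.span_coe_span_eq] at hfb
  obtain ⟨r, hr, hfr⟩ := exists_sum_mul_of_mem_span_range
    (v := Sum.elim d b) (by rintro (i | i); exacts [hd i, hb i]) hf hfb
  have hrep : ∀ j, ∃ q : δ ⊕ ι → MvPolynomial σ k, (∀ i, (q i).IsHomogeneous n) ∧
      r (Sum.inr j) - φ (r (Sum.inr j)) = ∑ i, Sum.elim d a i * q i := by
    intro j
    refine exists_sum_mul_of_mem_span_range (by rintro (i | i); exacts [hd i, ha i])
      ((hr _).sub (hφh _ _ (hr _))) ?_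
    rw [← Ideal.span_coe_span_eq, Set.Sum.elim_range, Submodule.span_union]
    exact hφs _
  choose q hq hrq using hrep
  refine ⟨fun i => r (Sum.inl i) + ∑ j, b j * q j (Sum.inl i), fun i j => q j (Sum.inr i),
    ?_, fun i j => hq _ _, ?_⟩
  · intro i
    refine (hr _).add (IsHomogeneous.sum _ _ _ fun j _ => ?_)
    rw [add_comm n 1]
    exact (hb j).mul (hq _ _)
  · have h0 : ∑ j, b j * φ (r (Sum.inr j)) = 0 := by
      rw [hfr, Fintype.sum_sum_type, map_add, map_sum, map_sum] at hφf
      simp only [Sum.elim_inl, Sum.elim_inr, map_mul] at hφf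
      rw [Finset.sum_eq_zero, zero_add] at hφf
      · rw [← hφf]
        refine Finset.sum_congr rfl fun j _ => ?_
        rw [hφb (b j) (Submodule.subset_span ⟨j, rfl⟩) (hb j)]
      · intro i _
        rw [hφ0 (d i) (Submodule.mem_sup_left (Submodule.subset_span ⟨i, rfl⟩)), zero_mul]
    have h1 : ∑ j, b j * r (Sum.inr j) = ∑ j, b j * (∑ i, Sum.elim d a i * q j i) := by
      rw [← sub_zero (∑ j, b j * r (Sum.inr j)), ← h0, ← Finset.sum_sub_distrib]
      refine Finset.sum_congr rfl fun j _ => ?_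
      rw [← mul_sub, hrq]
    rw [hfr, Fintype.sum_sum_type]
    simp only [Sum.elim_inl, Sum.elim_inr]
    rw [h1]
    simp only [Fintype.sum_sum_type, Sum.elim_inl, Sum.elim_inr, mul_add,
      Finset.sum_add_distrib, Finset.mul_sum]
    rw [add_assoc]
    congr 1
    congr 1
    · rw [Finset.sum_comm]
      exact Finset.sum_congr rfl fun i _ => Finset.sum_congr rfl fun j _ => by ring
    · rw [Finset.sum_comm]
      exact Finset.sum_congr rfl fun i _ => Finset.sum_congr rfl fun j _ => by ring

theorem aeval_X_eq_of_isHomogeneous_one (η : Dual k (MvPolynomial σ k)) {v : MvPolynomial σ k}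
    (hv : v.IsHomogeneous 1) : aeval (fun i => η (X i)) v = η v := by
  rw [← mem_homogeneousSubmodule, homogeneousSubmodule_one_eq_span_X] at hv
  induction hv using Submodule.span_induction with
  | mem x hx =>
    obtain ⟨i, rfl⟩ := hx
    simp
  | zero => simp
  | add x y _ _ hx hy => rw [map_add, map_add, hx, hy]
  | smul c x _ hx => rw [map_smul, map_smul, hx]

/-- If a cubic `∑ x t * y t * l t` lies in the ideal of `P`, then every zero of `P` yields a linear
relation between the `l t` modulo the span of `P` and the `x t`, `y t`. -/
theorem sum_smul_mem_of_mem_span {ι : Type*} [Fintype ι] {P W : Submodule k (MvPolynomial σ k)}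
    (hP : P ≤ homogeneousSubmodule σ k 1) (hW : W ≤ homogeneousSubmodule σ k 1)
    {x y l : ι → MvPolynomial σ k} (hx : ∀ i, x i ∈ W) (hy : ∀ i, y i ∈ W)
    (hl : ∀ i, (l i).IsHomogeneous 1)
    (hf : ∑ i, x i * y i * l i ∈ Ideal.span (P : Set (MvPolynomial σ k)))
    {η : Dual k (MvPolynomial σ k)} (hη : ∀ p ∈ P, η p = 0) :
    ∑ i, (η (x i) * η (y i)) • l i ∈ P ⊔ W := by
  have hval : ∀ ζ : Dual k (MvPolynomial σ k), (∀ p ∈ P, ζ p = 0) →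
      ∑ i, ζ (x i) * ζ (y i) * ζ (l i) = 0 := by
    intro ζ hζ
    have := algHom_eq_zero_of_mem_span (φ := aeval (fun i => ζ (X i)))
      (fun p hp => (aeval_X_eq_of_isHomogeneous_one ζ (hP hp)).trans (hζ p hp)) hf
    rw [map_sum] at this
    rw [← this]
    refine Finset.sum_congr rfl fun i _ => ?_
    rw [map_mul, map_mul, aeval_X_eq_of_isHomogeneous_one ζ (hW (hx i)),
      aeval_X_eq_of_isHomogeneous_one ζ (hW (hy i)), aeval_X_eq_of_isHomogeneous_one ζ (hl i)]
  by_contra hnot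
  obtain ⟨w, hw, hker⟩ := Submodule.exists_le_ker_of_notMem hnot
  have hwP : ∀ p ∈ P, w p = 0 := fun p hp => hker (Submodule.mem_sup_left hp)
  have hwW : ∀ p ∈ W, w p = 0 := fun p hp => hker (Submodule.mem_sup_right hp)
  have h1 := hval η hη
  have h2 := hval (η + w) fun p hp => by simp [hη p hp, hwP p hp]
  simp only [LinearMap.add_apply, hwW _ (hx _), hwW _ (hy _), add_zero, mul_add,
    Finset.sum_add_distrib, h1, zero_add] at h2
  apply hw
  rw [map_sum, ← h2]
  simp

end LinearForms

section UpperBound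

variable {k σ : Type*} [Field k]

/-- Every space of linear forms whose ideal contains `f` has dimension at least `3`. -/
def SliceRankGEThree (f : MvPolynomial σ k) : Prop :=
  ∀ Q ≤ homogeneousSubmodule σ k 1, FiniteDimensional k Q →
    f ∈ Ideal.span (Q : Set (MvPolynomial σ k)) → 3 ≤ finrank k Q

/-- `P` is a three-dimensional space of linear forms whose ideal contains `f`. -/
structure IsSliceSpace (f : MvPolynomial σ k) (P : Submodule k (MvPolynomial σ k)) : Prop where
  le : P ≤ homogeneousSubmodule σ k 1
  finrank_eq : finrank k P = 3
  mem : f ∈ Ideal.span (P : Set (MvPolynomial σ k))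

theorem IsSliceSpace.finiteDimensional {f : MvPolynomial σ k}
    {P : Submodule k (MvPolynomial σ k)} (hP : IsSliceSpace f P) : FiniteDimensional k P :=
  FiniteDimensional.of_finrank_pos (by rw [hP.finrank_eq]; norm_num)

/-- If `f = h + g` with `h` in the ideal generated by a subspace of `P` and `g` a polynomial in the
forms of `U`, then `U` contains every slice space `P` of `f`. -/
theorem IsSliceSpace.le_of_add_mem_adjoin {f g h : MvPolynomial σ k}
    {P D U : Submodule k (MvPolynomial σ k)} (hf : SliceRankGEThree f) (hP : IsSliceSpace f P)
    (hU : U ≤ homogeneousSubmodule σ k 1) (hDP : D ≤ P) (hDU : D ≤ U)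
    (hh : h ∈ Ideal.span (D : Set (MvPolynomial σ k)))
    (hg : g ∈ Algebra.adjoin k (U : Set (MvPolynomial σ k))) (hfgh : f = h + g) : P ≤ U := by
  have := hP.finiteDimensional
  have hgP : g ∈ Ideal.span (P : Set (MvPolynomial σ k)) := by
    have : g = f - h := by rw [hfgh]; ring
    rw [this]
    exact Ideal.sub_mem _ hP.mem (Ideal.span_mono hDP hh)
  have hfPU : f ∈ Ideal.span
      ((P ⊓ U : Submodule k (MvPolynomial σ k)) : Set (MvPolynomial σ k)) := by
    rw [hfgh]
    exact Ideal.add_mem _ (Ideal.span_mono (le_inf hDP hDU : D ≤ P ⊓ U) hh)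
      (mem_span_inf_of_mem_adjoin hP.le hU hg hgP)
  have h3 := hf (P ⊓ U) (inf_le_left.trans hP.le) inferInstance hfPU
  have : P ⊓ U = P := Submodule.eq_of_le_of_finrank_le inf_le_left (by rw [hP.finrank_eq]; exact h3)
  exact inf_eq_left.1 this

/-- The bilinear map whose matrix is `l`. -/
noncomputable def bilinearOfMatrix {V : Type*} [AddCommGroup V] [Module k V] {ι κ : Type*}
    [Fintype ι] [Fintype κ] (l : ι → κ → V) : (ι → k) →ₗ[k] (κ → k) →ₗ[k] V :=
  ∑ i, ∑ j, (LinearMap.proj i).smulRight ((LinearMap.proj j).smulRight (l i j))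

theorem bilinearOfMatrix_apply {V : Type*} [AddCommGroup V] [Module k V] {ι κ : Type*}
    [Fintype ι] [Fintype κ] (l : ι → κ → V) (u : ι → k) (v : κ → k) :
    bilinearOfMatrix l u v = ∑ i, ∑ j, (u i * v j) • l i j := by
  simp [bilinearOfMatrix, LinearMap.sum_apply, smul_smul]

theorem mem_map₂_bilinearOfMatrix {V : Type*} [AddCommGroup V] [Module k V] {ι κ : Type*}
    [Fintype ι] [Fintype κ] (l : ι → κ → V) (i : ι) (j : κ) :
    l i j ∈ Submodule.map₂ (bilinearOfMatrix (k := k) l) ⊤ ⊤ := by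
  classical
  have : l i j = bilinearOfMatrix l (Pi.single i (1 : k)) (Pi.single j (1 : k)) := by
    rw [bilinearOfMatrix_apply, Finset.sum_eq_single i, Finset.sum_eq_single j]
    · simp
    · intro j' _ h
      simp [h]
    · simp
    · intro i' _ h
      simp [h]
    · simp
  rw [this]
  exact Submodule.apply_mem_map₂ _ trivial trivial

theorem map₂_bilinearOfMatrix_le {V : Type*} [AddCommGroup V] [Module k V] {ι κ : Type*}
    [Fintype ι] [Fintype κ] {l : ι → κ → V} {X : Submodule k V} (h : ∀ i j, l i j ∈ X) :
    Submodule.map₂ (bilinearOfMatrix (k := k) l) ⊤ ⊤ ≤ X := by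
  rw [Submodule.map₂_le]
  intro u _ v _
  rw [bilinearOfMatrix_apply]
  exact Submodule.sum_mem _ fun i _ => Submodule.sum_mem _ fun j _ => X.smul_mem _ (h i j)

theorem exists_map₂_le_of_isSliceSpace {f : MvPolynomial σ k} {a b : Fin 3 → MvPolynomial σ k}
    {l : Fin 3 → Fin 3 → MvPolynomial σ k} {P₁ P₂ P : Submodule k (MvPolynomial σ k)}
    (hP₁ : P₁ ≤ homogeneousSubmodule σ k 1) (hP₂ : P₂ ≤ homogeneousSubmodule σ k 1)
    (ha : Submodule.span k (Set.range a) = P₁) (hb : Submodule.span k (Set.range b) = P₂)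
    (hl : ∀ i j, (l i j).IsHomogeneous 1)
    (hf : f = ∑ i, ∑ j, a i * b j * l i j) (hP : IsSliceSpace f P) :
    ∃ A B : Submodule k (Fin 3 → k),
      Submodule.map₂ (bilinearOfMatrix l) A B ≤ P ⊔ (P₁ ⊔ P₂) ∧
      finrank k (P ⊔ (P₁ ⊔ P₂) : Submodule k (MvPolynomial σ k)) ≤
        finrank k A + finrank k B + 3 := by
  have := hP.finiteDimensional
  have hfd₁ : FiniteDimensional k P₁ := ha ▸ FiniteDimensional.span_of_finite k (Set.finite_range a)
  refine ⟨evalAnnihilator P a, evalAnnihilator (P ⊔ P₁) b, ?_, ?_⟩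
  · rw [Submodule.map₂_le]
    intro u hu v hv
    obtain ⟨η, hη, hηa⟩ := mem_evalAnnihilator.1 hu
    obtain ⟨ζ, hζ, hζb⟩ := mem_evalAnnihilator.1 hv
    have haP : ∀ i, a i ∈ P₁ := fun i => ha ▸ Submodule.subset_span ⟨i, rfl⟩
    have hbP : ∀ i, b i ∈ P₂ := fun i => hb ▸ Submodule.subset_span ⟨i, rfl⟩
    have hmem := hP.mem
    rw [hf, ← Fintype.sum_prod_type'] at hmem
    have key : ∀ ξ : Dual k (MvPolynomial σ k), (∀ p ∈ P, ξ p = 0) →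
        bilinearOfMatrix l (fun i => ξ (a i)) (fun i => ξ (b i)) ∈ P ⊔ (P₁ ⊔ P₂) := by
      intro ξ hξ
      rw [bilinearOfMatrix_apply, ← Fintype.sum_prod_type']
      exact sum_smul_mem_of_mem_span (x := fun p : Fin 3 × Fin 3 => a p.1)
        (y := fun p => b p.2) (l := fun p => l p.1 p.2) hP.le (sup_le hP₁ hP₂)
        (fun i => Submodule.mem_sup_left (haP i.1)) (fun i => Submodule.mem_sup_right (hbP i.2))
        (fun i => hl i.1 i.2) hmem hξ
    have h1 := key η hη
    have h2 := key (η + ζ) fun p hp => by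
      simp [hη p hp, hζ p (Submodule.mem_sup_left hp)]
    have hua : (fun i => η (a i)) = u := funext hηa
    have hua' : (fun i => (η + ζ) (a i)) = u := by
      ext i
      simp [hηa, hζ _ (Submodule.mem_sup_right (haP i))]
    have hvb : (fun i => (η + ζ) (b i)) = (fun i => η (b i)) + v := by
      ext i
      simp [hζb]
    rw [hua', hvb, map_add] at h2
    rw [hua] at h1
    simpa using Submodule.sub_mem _ h2 h1
  · have h1 := finrank_sup_span_le_add_finrank_evalAnnihilator P a
    have h2 := finrank_sup_span_le_add_finrank_evalAnnihilator (P ⊔ P₁) b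
    rw [ha, hP.finrank_eq] at h1
    rw [hb, sup_assoc] at h2
    omega

theorem exists_finrank_le_twelve_of_disjoint {f : MvPolynomial σ k} (hf3 : f.IsHomogeneous 3)
    (hf : SliceRankGEThree f) {S : Set (Submodule k (MvPolynomial σ k))}
    (hS : ∀ P ∈ S, IsSliceSpace f P) {P₁ P₂ : Submodule k (MvPolynomial σ k)}
    (h₁ : P₁ ∈ S) (h₂ : P₂ ∈ S) (hdis : Disjoint P₁ P₂) :
    ∃ N : Submodule k (MvPolynomial σ k), FiniteDimensional k N ∧ finrank k N ≤ 12 ∧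
      ∀ P ∈ S, P ≤ N := by
  have hfd₁ := (hS _ h₁).finiteDimensional
  have hfd₂ := (hS _ h₂).finiteDimensional
  obtain ⟨a, ha⟩ := Submodule.exists_span_range_eq P₁ (hS _ h₁).finrank_eq
  obtain ⟨b, hb⟩ := Submodule.exists_span_range_eq P₂ (hS _ h₂).finrank_eq
  have haP : ∀ i, a i ∈ P₁ := fun i => ha ▸ Submodule.subset_span ⟨i, rfl⟩
  have hbP : ∀ i, b i ∈ P₂ := fun i => hb ▸ Submodule.subset_span ⟨i, rfl⟩
  obtain ⟨q, l, -, hl, hfl⟩ := exists_eq_sum_add_sum_of_mem_span (n := 1) (f := f)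
    (d := (Fin.elim0 : Fin 0 → MvPolynomial σ k)) (a := a) (b := b) (fun i => i.elim0)
    (fun i => (hS _ h₁).le (haP i)) (fun i => (hS _ h₂).le (hbP i))
    (by simpa [Set.range_eq_empty, ha, hb] using hdis) hf3
    (by simpa [Set.range_eq_empty, ha, hb] using (hS _ h₁).mem)
    (by simpa [Set.range_eq_empty, ha, hb] using (hS _ h₂).mem)
  rw [Finset.univ_eq_empty, Finset.sum_empty, zero_add] at hfl
  have hW6 : finrank k (P₁ ⊔ P₂ : Submodule k (MvPolynomial σ k)) = 6 := by
    have := Submodule.finrank_sup_add_finrank_inf_eq P₁ P₂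
    rw [hdis.eq_bot, finrank_bot, (hS _ h₁).finrank_eq, (hS _ h₂).finrank_eq] at this
    exact this
  have hAB := fun P hP => exists_map₂_le_of_isSliceSpace (hS _ h₁).le (hS _ h₂).le ha hb hl hfl
    (hS P hP)
  set W := P₁ ⊔ P₂ with hW
  set L := bilinearOfMatrix (k := k) l with hL
  have hfdL : FiniteDimensional k (Submodule.map₂ L ⊤ ⊤) :=
    Module.Finite.of_fg (Submodule.FG.map₂ _ Module.Finite.fg_top Module.Finite.fg_top)
  have hW1 : W ≤ homogeneousSubmodule σ k 1 := sup_le (hS _ h₁).le (hS _ h₂).le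
  have hN : ∀ P ∈ S, P ≤ W ⊔ Submodule.map₂ L ⊤ ⊤ := by
    intro P hP
    refine (hS P hP).le_of_add_mem_adjoin (D := ⊥) (h := 0) (g := f) hf
      (sup_le hW1 (map₂_bilinearOfMatrix_le hl)) bot_le bot_le (Ideal.zero_mem _) ?_
      (zero_add _).symm
    rw [hfl]
    refine Subalgebra.sum_mem _ fun i _ => Subalgebra.sum_mem _ fun j _ =>
      Subalgebra.mul_mem _ (Subalgebra.mul_mem _ ?_ ?_) ?_
    · exact Algebra.subset_adjoin (Submodule.mem_sup_left (Submodule.mem_sup_left (haP i)))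
    · exact Algebra.subset_adjoin (Submodule.mem_sup_left (Submodule.mem_sup_right (hbP j)))
    · exact Algebra.subset_adjoin (Submodule.mem_sup_right (mem_map₂_bilinearOfMatrix l i j))
  have hbound : ∀ (X : Submodule k (MvPolynomial σ k)) [FiniteDimensional k X]
      (A B : Submodule k (Fin 3 → k)), W ≤ X → Submodule.map₂ L A B ≤ X →
      finrank k (W ⊔ Submodule.map₂ L ⊤ ⊤ : Submodule k (MvPolynomial σ k)) +
        finrank k A * finrank k B ≤ finrank k X + 9 := by
    intro X _ A B hWX hAB
    have h := Submodule.finrank_sup_map₂_top_add_le L A B X hAB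
    have h' := Submodule.finrank_mono (sup_le_sup_right hWX (Submodule.map₂ L ⊤ ⊤))
    rw [finrank_fintype_fun_eq_card, Fintype.card_fin] at h
    omega
  by_cases hsmall : finrank k (W ⊔ Submodule.map₂ L ⊤ ⊤ : Submodule k (MvPolynomial σ k)) ≤ 12
  · exact ⟨_, inferInstance, hsmall, hN⟩
  have hle3 : ∀ A : Submodule k (Fin 3 → k), finrank k A ≤ 3 := fun A => by
    simpa using Submodule.finrank_le A
  have htype : ∀ P ∈ S, ¬ P ≤ W →
      finrank k (P ⊔ W : Submodule k (MvPolynomial σ k)) = 7 ∧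
      ((∃ A : Submodule k (Fin 3 → k), finrank k A = 1 ∧ Submodule.map₂ L A ⊤ ≤ P ⊔ W) ∨
      ∃ B : Submodule k (Fin 3 → k), finrank k B = 1 ∧ Submodule.map₂ L ⊤ B ≤ P ⊔ W) := by
    intro P hP hPW
    have := (hS _ hP).finiteDimensional
    obtain ⟨A, B, hABle, hrk⟩ := hAB P hP
    have h1 := hbound (P ⊔ W) A B le_sup_right hABle
    have h2 : finrank k (P ⊔ W : Submodule k (MvPolynomial σ k)) ≤ 9 := by
      have := Submodule.finrank_add_le_finrank_add_finrank P W
      rw [(hS _ hP).finrank_eq] at this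
      omega
    have h3 : finrank k W < finrank k (P ⊔ W : Submodule k (MvPolynomial σ k)) :=
      Submodule.finrank_lt_finrank_of_lt (right_lt_sup.2 hPW)
    have hA := hle3 A
    have hB := hle3 B
    have htop : ∀ A : Submodule k (Fin 3 → k), finrank k A = 3 → A = ⊤ := fun A hA =>
      Submodule.eq_top_of_finrank_eq (by simpa using hA)
    have hcases : finrank k (P ⊔ W : Submodule k (MvPolynomial σ k)) = 7 ∧
        (finrank k A = 1 ∧ finrank k B = 3 ∨ finrank k A = 3 ∧ finrank k B = 1) := by
      generalize finrank k A = x at *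
      generalize finrank k B = y at *
      interval_cases x <;> interval_cases y <;> omega
    refine ⟨hcases.1, hcases.2.imp ?_ ?_⟩
    · rintro ⟨hA, hB⟩
      exact ⟨A, hA, htop B hB ▸ hABle⟩
    · rintro ⟨hA, hB⟩
      exact ⟨B, hB, htop A hA ▸ hABle⟩
  by_cases hall : ∀ P ∈ S, P ≤ W
  · exact ⟨W, inferInstance, by omega, hall⟩
  push Not at hall
  obtain ⟨P, hP, hPW⟩ := hall
  have hfdP := (hS _ hP).finiteDimensional
  refine ⟨P ⊔ W, inferInstance, by rw [(htype P hP hPW).1]; norm_num, fun P' hP' => ?_⟩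
  by_contra hP'W
  exfalso
  have hfdP' := (hS _ hP').finiteDimensional
  have hP'W' : ¬ P' ≤ W := fun h => hP'W (h.trans le_sup_right)
  obtain ⟨h7, ht⟩ := htype P hP hPW
  obtain ⟨h7', ht'⟩ := htype P' hP' hP'W'
  set X := P ⊔ W with hX
  set X' := P' ⊔ W with hX'
  have hlt : finrank k X < finrank k (X ⊔ X' : Submodule k (MvPolynomial σ k)) :=
    Submodule.finrank_lt_finrank_of_lt (left_lt_sup.2 fun h => hP'W (le_sup_left.trans h))
  have hsum := Submodule.finrank_sup_add_finrank_inf_eq X X'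
  have hinf : W ≤ X ⊓ X' := le_inf le_sup_right le_sup_right
  have hinf6 := Submodule.finrank_mono hinf
  have hinfW : X ⊓ X' = W :=
    (Submodule.eq_of_le_of_finrank_le hinf (by omega)).symm
  have h8 : finrank k (X ⊔ X' : Submodule k (MvPolynomial σ k)) = 8 := by omega
  have hline : ∀ A B : Submodule k (Fin 3 → k), finrank k A = 1 → finrank k B = 1 → A ≠ B →
      finrank k (A ⊔ B : Submodule k (Fin 3 → k)) ≥ 2 := by
    intro A B hA hB hne
    by_contra hlt
    have h := Submodule.eq_of_le_of_finrank_le (le_sup_left : A ≤ A ⊔ B) (by omega)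
    have h' := Submodule.eq_of_le_of_finrank_le (le_sup_right : B ≤ A ⊔ B) (by omega)
    exact hne (h.trans h'.symm)
  have h3 : finrank k (⊤ : Submodule k (Fin 3 → k)) = 3 := by simp
  have hmixed : ∀ A B : Submodule k (Fin 3 → k), finrank k A = 1 → finrank k B = 1 →
      Submodule.map₂ L A ⊤ ≤ X ⊔ X' → Submodule.map₂ L ⊤ B ≤ X ⊔ X' → False := by
    intro A B hA hB hAX hBX
    have h := Submodule.finrank_sup_map₂_top_le_of_le L A B (X ⊔ X') hAX hBX
    have h' := Submodule.finrank_mono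
      (sup_le_sup_right (le_sup_right.trans le_sup_left : W ≤ X ⊔ X') (Submodule.map₂ L ⊤ ⊤))
    rw [finrank_fintype_fun_eq_card, Fintype.card_fin, hA, hB] at h
    omega
  have hWX : W ≤ X ⊔ X' := le_sup_right.trans le_sup_left
  rcases ht with ⟨A, hA, hAX⟩ | ⟨B, hB, hBX⟩ <;> rcases ht' with ⟨A', hA', hAX'⟩ | ⟨B', hB', hBX'⟩
  · rcases eq_or_ne A A' with rfl | hne
    · have := hbound W A ⊤ le_rfl (hinfW ▸ le_inf hAX hAX')
      rw [h3] at this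
      omega
    · have := hbound (X ⊔ X') (A ⊔ A') ⊤ hWX
        (Submodule.map₂_sup_left L A A' ⊤ ▸ sup_le_sup hAX hAX')
      have := hline A A' hA hA' hne
      rw [h3] at *
      omega
  · exact hmixed A B' hA hB' (hAX.trans le_sup_left) (hBX'.trans le_sup_right)
  · exact hmixed A' B hA' hB (hAX'.trans le_sup_right) (hBX.trans le_sup_left)
  · rcases eq_or_ne B B' with rfl | hne
    · have := hbound W ⊤ B le_rfl (hinfW ▸ le_inf hBX hBX')
      rw [h3] at this
      omega
    · have := hbound (X ⊔ X') ⊤ (B ⊔ B') hWX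
        (Submodule.map₂_sup_right L ⊤ B B' ▸ sup_le_sup hBX hBX')
      have := hline B B' hB hB' hne
      rw [h3] at *
      omega

end UpperBound

section MeetingInALine

variable {k σ : Type*} [Field k]

theorem Submodule.exists_span_sup_span_eq {V : Type*} [AddCommGroup V] [Module k V]
    {P : Submodule k V} (hP : finrank k P = 3) {d α : V} (hd : d ∈ P) (hα : α ∈ P) (hd0 : d ≠ 0)
    (hαd : α ∉ Submodule.span k {d}) :
    ∃ a : Fin 2 → V, a 0 = α ∧
      Submodule.span k {d} ⊔ Submodule.span k (Set.range a) = P := by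
  have : FiniteDimensional k P := FiniteDimensional.of_finrank_pos (by rw [hP]; norm_num)
  set T := Submodule.span k {d} ⊔ Submodule.span k {α} with hT
  have h1 : finrank k (Submodule.span k {d}) = 1 := finrank_span_singleton hd0
  have h2 : finrank k (Submodule.span k {d}) < finrank k T :=
    Submodule.finrank_lt_finrank_of_lt (left_lt_sup.2 (by simpa using hαd))
  have hTP : T ≤ P := sup_le (by simpa using hd) (by simpa using hα)
  obtain ⟨β, hβP, hβ⟩ : ∃ β ∈ P, β ∉ T := by
    by_contra! h
    have h3 := Submodule.finrank_mono (h : P ≤ T)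
    have h4 := Submodule.finrank_add_le_finrank_add_finrank (Submodule.span k {d})
      (Submodule.span k {α})
    have h5 := finrank_span_le_card (R := k) ({α} : Set V)
    simp only [Set.toFinset_singleton, Finset.card_singleton] at h5
    rw [← hT] at h4
    omega
  refine ⟨![α, β], rfl, ?_⟩
  have h3 : finrank k T < finrank k (T ⊔ Submodule.span k {β} : Submodule k V) :=
    Submodule.finrank_lt_finrank_of_lt (left_lt_sup.2 (by simpa using hβ))
  have h4 : T ⊔ Submodule.span k {β} = P :=
    Submodule.eq_of_le_of_finrank_le (sup_le hTP (by simpa using hβP)) (by omega)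
  rw [Matrix.range_cons, Matrix.range_cons, Matrix.range_empty, Set.union_empty,
    Submodule.span_union, ← sup_assoc, ← hT, h4]

/-- If `f = d * q + ∑ a i * b j * l i j` with `a i`, `b j` in `W` lies in the ideal of `P` and
`d` does not lie in `P`, then `q` lies in the ideal of `W ⊔ P`. -/
theorem mem_span_sup_of_mul_add_mem {ι : Type*} [Fintype ι] {P W : Submodule k (MvPolynomial σ k)}
    (hP : P ≤ homogeneousSubmodule σ k 1) (hW : W ≤ homogeneousSubmodule σ k 1)
    {d q : MvPolynomial σ k} (hd : d ∈ W) (hdP : d ∉ P) {x y l : ι → MvPolynomial σ k}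
    (hx : ∀ i, x i ∈ W) (hy : ∀ i, y i ∈ W)
    (hf : d * q + ∑ i, x i * y i * l i ∈ Ideal.span (P : Set (MvPolynomial σ k))) :
    q ∈ Ideal.span ((W ⊔ P : Submodule k (MvPolynomial σ k)) : Set (MvPolynomial σ k)) := by
  obtain ⟨η, hηd, hη⟩ := Submodule.exists_le_ker_of_notMem hdP
  set J := Ideal.span ((W ⊔ P : Submodule k (MvPolynomial σ k)) : Set (MvPolynomial σ k))
  have hWJ : ∀ w ∈ W, w ∈ J := fun w hw => Ideal.subset_span (Submodule.mem_sup_left hw)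
  set D : Derivation k (MvPolynomial σ k) (MvPolynomial σ k) :=
    mkDerivation k fun i => C (η (X i)) with hD
  have hD1 : ∀ v ∈ homogeneousSubmodule σ k 1, D v = C (η v) := by
    intro v hv
    rw [homogeneousSubmodule_one_eq_span_X] at hv
    induction hv using Submodule.span_induction with
    | mem x hx =>
      obtain ⟨i, rfl⟩ := hx
      simp [hD, mkDerivation_X]
    | zero => simp
    | add x y _ _ hx hy => rw [map_add, map_add, map_add, hx, hy]
    | smul c x _ hx =>
      rw [Derivation.map_smul, map_smul, hx, smul_eq_mul, C_mul, MvPolynomial.smul_eq_C_mul]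
  have hDf : ∀ g ∈ Ideal.span (P : Set (MvPolynomial σ k)), D g ∈ J := by
    intro g hg
    induction hg using Submodule.span_induction with
    | mem x hx =>
      rw [hD1 x (hP hx), LinearMap.mem_ker.1 (hη hx), C_0]
      exact J.zero_mem
    | zero => simp
    | add x y _ _ hx hy =>
      rw [map_add]
      exact J.add_mem hx hy
    | smul c x hx hDx =>
      rw [smul_eq_mul, Derivation.leibniz, smul_eq_mul, smul_eq_mul]
      have : x ∈ J := Ideal.span_mono (le_sup_right : P ≤ W ⊔ P) hx
      exact J.add_mem (J.mul_mem_left _ hDx) (J.mul_mem_right _ this)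
  have hsum : ∀ i, D (x i * y i * l i) ∈ J := by
    intro i
    simp only [Derivation.leibniz, smul_eq_mul]
    refine J.add_mem (J.mul_mem_right _ (J.mul_mem_right _ (hWJ _ (hx i))))
      (J.mul_mem_left _ (J.add_mem ?_ ?_))
    · exact J.mul_mem_right _ (hWJ _ (hx i))
    · exact J.mul_mem_right _ (hWJ _ (hy i))
  have h := hDf _ hf
  rw [map_add, map_sum] at h
  have h1 := (Submodule.add_mem_iff_left J (J.sum_mem fun i _ => hsum i)).1 h
  rw [Derivation.leibniz, smul_eq_mul, smul_eq_mul, hD1 d (hW hd)] at h1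
  have h2 := (Submodule.add_mem_iff_right J (J.mul_mem_right _ (hWJ d hd))).1 h1
  have h3 := J.mul_mem_left (C (η d)⁻¹) h2
  rw [mul_comm q, ← mul_assoc, ← C_mul, inv_mul_cancel₀ hηd, C_1, one_mul] at h3
  exact h3

theorem mem_span_of_mem_span_sup_singleton {W : Submodule k (MvPolynomial σ k)}
    [FiniteDimensional k W] (hW : W ≤ homogeneousSubmodule σ k 1)
    {q z₁ z₂ z₃ : MvPolynomial σ k} (hq : q.IsHomogeneous 2)
    (hz₁ : z₁.IsHomogeneous 1) (hz₂ : z₂.IsHomogeneous 1) (hz₃ : z₃.IsHomogeneous 1)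
    (h₁ : z₁ ∉ W) (h₂ : z₂ ∉ W ⊔ Submodule.span k {z₁})
    (h₃ : z₃ ∉ W ⊔ Submodule.span k {z₁} ⊔ Submodule.span k {z₂})
    (hq₁ : q ∈ Ideal.span ((W ⊔ Submodule.span k {z₁} : Submodule k (MvPolynomial σ k)) :
      Set (MvPolynomial σ k)))
    (hq₂ : q ∈ Ideal.span ((W ⊔ Submodule.span k {z₂} : Submodule k (MvPolynomial σ k)) :
      Set (MvPolynomial σ k)))
    (hq₃ : q ∈ Ideal.span ((W ⊔ Submodule.span k {z₃} : Submodule k (MvPolynomial σ k)) :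
      Set (MvPolynomial σ k))) :
    q ∈ Ideal.span (W : Set (MvPolynomial σ k)) := by
  obtain ⟨w, hw⟩ := Submodule.exists_span_range_eq W rfl
  have hwW : ∀ i, w i ∈ W := fun i => hw ▸ Submodule.subset_span ⟨i, rfl⟩
  have hr : ∀ z : MvPolynomial σ k, Set.range (fun _ : Unit => z) = {z} := fun z => by simp
  obtain ⟨p, c, -, hc, hqeq⟩ := exists_eq_sum_add_sum_of_mem_span (n := 0) (d := w)
    (a := fun _ : Unit => z₁) (b := fun _ : Unit => z₂) (fun i => hW (hwW i))
    (fun _ => hz₁) (fun _ => hz₂) (by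
      rw [hw, hr, hr, Submodule.disjoint_span_singleton]
      exact fun h => absurd h h₂) hq (by rwa [hw, hr]) (by rwa [hw, hr])
  simp only [Finset.univ_unique, Finset.sum_singleton] at hqeq
  set c₀ := c default default
  have hc₀ : c₀ = C (coeff 0 c₀) := totalDegree_eq_zero_iff_eq_C.1
    (Nat.le_zero.1 (hc default default).totalDegree_le)
  obtain ⟨η, hη, hηz⟩ := exists_dual_eq_of_finrank W ![z₁, z₂, z₃] (by
    rw [Matrix.range_cons, Matrix.range_cons, Matrix.range_cons, Matrix.range_empty,
      Set.union_empty, Submodule.span_union, Submodule.span_union, ← sup_assoc, ← sup_assoc,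
      Fintype.card_fin]
    have e1 := Submodule.finrank_lt_finrank_of_lt
      (left_lt_sup.2 (by simpa using h₁) : W < W ⊔ Submodule.span k {z₁})
    have e2 := Submodule.finrank_lt_finrank_of_lt
      (left_lt_sup.2 (by simpa using h₂) :
        W ⊔ Submodule.span k {z₁} < W ⊔ Submodule.span k {z₁} ⊔ Submodule.span k {z₂})
    have e3 := Submodule.finrank_lt_finrank_of_lt
      (left_lt_sup.2 (by simpa using h₃) :
        W ⊔ Submodule.span k {z₁} ⊔ Submodule.span k {z₂} <
          W ⊔ Submodule.span k {z₁} ⊔ Submodule.span k {z₂} ⊔ Submodule.span k {z₃})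
    omega) ![1, 1, 0]
  have hη1 : η z₁ = 1 := hηz 0
  have hη2 : η z₂ = 1 := hηz 1
  have hη3 : η z₃ = 0 := hηz 2
  have hle : W ⊔ Submodule.span k {z₃} ≤ LinearMap.ker η :=
    sup_le hη (by simpa using hη3)
  have h0 := algHom_eq_zero_of_mem_span (φ := aeval (fun i => η (X i))) (fun x hx =>
    (aeval_X_eq_of_isHomogeneous_one η
      (sup_le hW (by simpa using hz₃) hx : x ∈ homogeneousSubmodule σ k 1)).trans (hle hx)) hq₃
  rw [hqeq, map_add, map_sum, Finset.sum_eq_zero, zero_add, map_mul, map_mul,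
    aeval_X_eq_of_isHomogeneous_one η hz₁, aeval_X_eq_of_isHomogeneous_one η hz₂, hη1, hη2,
    one_mul, one_mul, hc₀, aeval_C] at h0
  · rw [hqeq, hc₀, show coeff 0 c₀ = 0 from h0, C_0, mul_zero, add_zero]
    exact Ideal.sum_mem _ fun i _ => Ideal.mul_mem_right _ _ (Ideal.subset_span (hwW i))
  · intro i _
    rw [map_mul, aeval_X_eq_of_isHomogeneous_one η (hW (hwW i)), hη _ (hwW i), zero_mul]

theorem exists_finrank_le_twelve_of_mem_span {f : MvPolynomial σ k} (hf : SliceRankGEThree f)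
    {P₀ W : Submodule k (MvPolynomial σ k)} (hW : W ≤ homogeneousSubmodule σ k 1)
    (hP₀ : IsSliceSpace f P₀) {d q : MvPolynomial σ k} {a b : Fin 2 → MvPolynomial σ k}
    {l : Fin 2 → Fin 2 → MvPolynomial σ k} (ha : a 0 ∈ P₀) (hb : b 0 ∈ P₀)
    (hWd : W = Submodule.span k (Set.range ![d, a 0, a 1, b 0, b 1]))
    (hq : q.IsHomogeneous 2) (hqW : q ∈ Ideal.span (W : Set (MvPolynomial σ k)))
    (hl : ∀ i j, (l i j).IsHomogeneous 1) (hfl : f = d * q + ∑ i, ∑ j, a i * b j * l i j)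
    (h6 : finrank k (P₀ ⊔ W : Submodule k (MvPolynomial σ k)) = 6) :
    ∃ N : Submodule k (MvPolynomial σ k), FiniteDimensional k N ∧ finrank k N ≤ 12 ∧
      ∀ P, IsSliceSpace f P → P ≤ N := by
  have hfdP := hP₀.finiteDimensional
  have hfdW : FiniteDimensional k W := hWd ▸ FiniteDimensional.span_of_finite k (Set.finite_range _)
  set x := ![d, a 0, a 1, b 0, b 1] with hx
  have hxW : ∀ i, x i ∈ W := fun i => hWd ▸ Submodule.subset_span ⟨i, rfl⟩
  have hdW : d ∈ W := hxW 0
  have haW : ∀ i, a i ∈ W := by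
    intro i
    fin_cases i
    exacts [hxW 1, hxW 2]
  have hbW : ∀ i, b i ∈ W := by
    intro i
    fin_cases i
    exacts [hxW 3, hxW 4]
  obtain ⟨m, hm, hqm⟩ := exists_sum_mul_of_mem_span_range (n := 1) (fun i => hW (hxW i)) hq
    (by rwa [hWd, Ideal.span_coe_span_eq] at hqW)
  have hlin : ∀ η : Dual k (MvPolynomial σ k), (∀ p ∈ P₀, η p = 0) →
      (η d * η d) • m 0 + (η d * η (a 1)) • m 2 + (η d * η (b 1)) • m 4 +
        (η (a 1) * η (b 1)) • l 1 1 ∈ P₀ ⊔ W := by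
    intro η hη
    have h := sum_smul_mem_of_mem_span (ι := Fin 5 ⊕ Fin 2 × Fin 2) hP₀.le hW
      (x := Sum.elim (fun _ => d) fun p => a p.1) (y := Sum.elim x fun p => b p.2)
      (l := Sum.elim m fun p => l p.1 p.2)
      (by rintro (i | p); exacts [hdW, haW _]) (by rintro (i | p); exacts [hxW _, hbW _])
      (by rintro (i | p); exacts [hm _, hl _ _])
      (by
        have h := hP₀.mem
        rw [hfl, hqm, Finset.mul_sum] at h
        simpa only [Fintype.sum_sum_type, Fintype.sum_prod_type, Sum.elim_inl, Sum.elim_inr,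
          mul_assoc] using h) hη
    simpa [Fintype.sum_sum_type, Fintype.sum_prod_type, Fin.sum_univ_succ, hx, hη _ ha, hη _ hb,
      add_assoc] using h
  have hle : P₀ ⊔ W ≤ P₀ ⊔ Submodule.span k (Set.range ![d, a 1, b 1]) := by
    refine sup_le le_sup_left ?_
    rw [hWd, Submodule.span_le, Set.range_subset_iff]
    have hs : ∀ i, ![d, a 1, b 1] i ∈ P₀ ⊔ Submodule.span k (Set.range ![d, a 1, b 1]) :=
      fun i => Submodule.mem_sup_right (Submodule.subset_span ⟨i, rfl⟩)
    intro i
    fin_cases i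
    exacts [hs 0, Submodule.mem_sup_left ha, hs 1, Submodule.mem_sup_left hb, hs 2]
  have hfds : FiniteDimensional k (Submodule.span k (Set.range ![d, a 1, b 1])) :=
    FiniteDimensional.span_of_finite k (Set.finite_range _)
  have hfun : ∀ c : Fin 3 → k, (c 0 * c 0) • m 0 + (c 0 * c 1) • m 2 + (c 0 * c 2) • m 4 +
      (c 1 * c 2) • l 1 1 ∈ P₀ ⊔ W := by
    intro c
    obtain ⟨η, hη, hηc⟩ := exists_dual_eq_of_finrank P₀ ![d, a 1, b 1] (by
      have := Submodule.finrank_mono hle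
      rw [Fintype.card_fin, hP₀.finrank_eq]
      omega) c
    have h0 : η d = c 0 := hηc 0
    have h1 : η (a 1) = c 1 := hηc 1
    have h2 : η (b 1) = c 2 := hηc 2
    have h := hlin η hη
    rwa [h0, h1, h2] at h
  have hm0 : m 0 ∈ P₀ ⊔ W := by simpa using hfun ![1, 0, 0]
  have hm2 : m 2 ∈ P₀ ⊔ W := by
    have : m 0 + m 2 ∈ P₀ ⊔ W := by simpa using hfun ![1, 1, 0]
    exact (Submodule.add_mem_iff_right _ hm0).1 this
  have hm4 : m 4 ∈ P₀ ⊔ W := by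
    have : m 0 + m 4 ∈ P₀ ⊔ W := by simpa using hfun ![1, 0, 1]
    exact (Submodule.add_mem_iff_right _ hm0).1 this
  have hl11 : l 1 1 ∈ P₀ ⊔ W := by simpa using hfun ![0, 1, 1]
  set v := ![m 1, m 3, l 0 0, l 0 1, l 1 0] with hv
  have hvN : ∀ i, v i ∈ P₀ ⊔ W ⊔ Submodule.span k (Set.range v) :=
    fun i => Submodule.mem_sup_right (Submodule.subset_span ⟨i, rfl⟩)
  have hfdv : FiniteDimensional k (Submodule.span k (Set.range v)) :=
    FiniteDimensional.span_of_finite k (Set.finite_range _)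
  refine ⟨P₀ ⊔ W ⊔ Submodule.span k (Set.range v), inferInstance, ?_, fun P hP => ?_⟩
  · have h1 := Submodule.finrank_add_le_finrank_add_finrank (P₀ ⊔ W) (Submodule.span k (Set.range v))
    have h2 := finrank_range_le_card (R := k) v
    rw [Fintype.card_fin] at h2
    simp only [Set.finrank] at h2
    omega
  · have hmN : ∀ i, m i ∈ P₀ ⊔ W ⊔ Submodule.span k (Set.range v) := by
      intro i
      fin_cases i
      exacts [Submodule.mem_sup_left hm0, hvN 0, Submodule.mem_sup_left hm2, hvN 1,
        Submodule.mem_sup_left hm4]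
    have hlN : ∀ i j, l i j ∈ P₀ ⊔ W ⊔ Submodule.span k (Set.range v) := by
      intro i j
      fin_cases i <;> fin_cases j
      exacts [hvN 2, hvN 3, hvN 4, Submodule.mem_sup_left hl11]
    have hWN : W ≤ P₀ ⊔ W ⊔ Submodule.span k (Set.range v) := le_sup_right.trans le_sup_left
    refine hP.le_of_add_mem_adjoin (D := ⊥) (h := 0) (g := f) hf (sup_le (sup_le hP₀.le hW) ?_)
      bot_le bot_le (Ideal.zero_mem _) ?_ (zero_add _).symm
    · rw [Submodule.span_le, Set.range_subset_iff]
      intro i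
      fin_cases i
      exacts [hm 1, hm 3, hl 0 0, hl 0 1, hl 1 0]
    · rw [hfl, hqm]
      refine Subalgebra.add_mem _ (Subalgebra.mul_mem _ (Algebra.subset_adjoin (hWN hdW))
        (Subalgebra.sum_mem _ fun i _ => Subalgebra.mul_mem _
          (Algebra.subset_adjoin (hWN (hxW i))) (Algebra.subset_adjoin (hmN i))))
        (Subalgebra.sum_mem _ fun i _ => Subalgebra.sum_mem _ fun j _ =>
          Subalgebra.mul_mem _ (Subalgebra.mul_mem _ (Algebra.subset_adjoin (hWN (haW i)))
            (Algebra.subset_adjoin (hWN (hbW j)))) (Algebra.subset_adjoin (hlN i j)))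

theorem exists_finrank_le_twelve_of_finrank_inf_eq_one {f : MvPolynomial σ k}
    (hf3 : f.IsHomogeneous 3) (hf : SliceRankGEThree f)
    {S : Set (Submodule k (MvPolynomial σ k))} (hS : ∀ P ∈ S, IsSliceSpace f P)
    (hnd : ∀ P ∈ S, ∀ P' ∈ S, ¬ Disjoint P P') {P₁ P₂ : Submodule k (MvPolynomial σ k)}
    (h₁ : P₁ ∈ S) (h₂ : P₂ ∈ S)
    (hinf : finrank k (P₁ ⊓ P₂ : Submodule k (MvPolynomial σ k)) = 1) :
    ∃ N : Submodule k (MvPolynomial σ k), FiniteDimensional k N ∧ finrank k N ≤ 12 ∧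
      ∀ P ∈ S, P ≤ N := by
  have hfd₁ := (hS _ h₁).finiteDimensional
  have hfd₂ := (hS _ h₂).finiteDimensional
  obtain ⟨d, hd, hd0, hdspan⟩ : ∃ d ∈ P₁ ⊓ P₂, d ≠ 0 ∧ P₁ ⊓ P₂ = Submodule.span k {d} := by
    obtain ⟨d, hd, hd0⟩ := Submodule.exists_mem_ne_zero_of_ne_bot
      (p := P₁ ⊓ P₂) fun h => by
        rw [h, finrank_bot] at hinf
        omega
    refine ⟨d, hd, hd0, (Submodule.eq_of_le_of_finrank_le (by simpa using hd) ?_).symm⟩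
    rw [hinf, finrank_span_singleton hd0]
  set W := P₁ ⊔ P₂ with hW
  have hW1 : W ≤ homogeneousSubmodule σ k 1 := sup_le (hS _ h₁).le (hS _ h₂).le
  have hW5 : finrank k W = 5 := by
    have := Submodule.finrank_sup_add_finrank_inf_eq P₁ P₂
    rw [hinf, (hS _ h₁).finrank_eq, (hS _ h₂).finrank_eq, ← hW] at this
    omega
  have hdW : d ∈ W := Submodule.mem_sup_left hd.1
  have hsup : ∀ P ∈ S, d ∉ P → finrank k (P ⊔ W : Submodule k (MvPolynomial σ k)) ≤ 6 := by
    intro P hP hdP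
    have := (hS _ hP).finiteDimensional
    have e1 : 1 ≤ finrank k (P ⊓ P₁ : Submodule k (MvPolynomial σ k)) :=
      Submodule.one_le_finrank_iff.2 fun h => hnd _ hP _ h₁ (disjoint_iff.2 h)
    have e2 : 1 ≤ finrank k (P ⊓ P₂ : Submodule k (MvPolynomial σ k)) :=
      Submodule.one_le_finrank_iff.2 fun h => hnd _ hP _ h₂ (disjoint_iff.2 h)
    have e3 : (P ⊓ P₁) ⊓ (P ⊓ P₂) = ⊥ := by
      rw [← inf_inf_distrib_left, hdspan, ← disjoint_iff]
      exact Submodule.disjoint_span_singleton_of_notMem hdP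
    have e4 := Submodule.finrank_sup_add_finrank_inf_eq (P ⊓ P₁) (P ⊓ P₂)
    rw [e3, finrank_bot] at e4
    have e5 := Submodule.finrank_mono (sup_le (inf_le_inf_left P le_sup_left)
      (inf_le_inf_left P le_sup_right) : (P ⊓ P₁) ⊔ (P ⊓ P₂) ≤ P ⊓ W)
    have e6 := Submodule.finrank_sup_add_finrank_inf_eq P W
    rw [(hS _ hP).finrank_eq] at e6
    omega
  have hdecomp : ∀ a b : Fin 2 → MvPolynomial σ k,
      Submodule.span k {d} ⊔ Submodule.span k (Set.range a) = P₁ →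
      Submodule.span k {d} ⊔ Submodule.span k (Set.range b) = P₂ →
      ∃ (q : MvPolynomial σ k) (l : Fin 2 → Fin 2 → MvPolynomial σ k),
        q.IsHomogeneous 2 ∧ (∀ i j, (l i j).IsHomogeneous 1) ∧
        f = d * q + ∑ i, ∑ j, a i * b j * l i j := by
    intro a b ha hb
    have hr : Set.range (fun _ : Unit => d) = {d} := by simp
    have hfdb : FiniteDimensional k (Submodule.span k (Set.range b)) :=
      FiniteDimensional.span_of_finite k (Set.finite_range _)
    have haP : ∀ i, a i ∈ P₁ := fun i =>
      ha ▸ Submodule.mem_sup_right (Submodule.subset_span ⟨i, rfl⟩)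
    have hbP : ∀ i, b i ∈ P₂ := fun i =>
      hb ▸ Submodule.mem_sup_right (Submodule.subset_span ⟨i, rfl⟩)
    have hdis : Disjoint P₁ (Submodule.span k (Set.range b)) := by
      have e1 := Submodule.finrank_sup_add_finrank_inf_eq P₁ (Submodule.span k (Set.range b))
      have e2 := finrank_range_le_card (R := k) b
      rw [Fintype.card_fin] at e2
      simp only [Set.finrank] at e2
      have e3 : W ≤ P₁ ⊔ Submodule.span k (Set.range b) := by
        rw [hW, ← hb, ← sup_assoc]
        exact sup_le_sup_right (sup_le le_rfl (by simpa using hd.1)) _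
      have e4 := Submodule.finrank_mono e3
      rw [(hS _ h₁).finrank_eq] at e1
      rw [disjoint_iff, ← Submodule.finrank_eq_zero (R := k)]
      omega
    obtain ⟨q, l, hq, hl, h⟩ := exists_eq_sum_add_sum_of_mem_span (n := 1) (f := f)
      (d := fun _ : Unit => d) (a := a) (b := b) (fun _ => (hS _ h₁).le hd.1)
      (fun i => (hS _ h₁).le (haP i)) (fun i => (hS _ h₂).le (hbP i))
      (by rwa [hr, ha]) hf3 (by rw [hr, ha]; exact (hS _ h₁).mem)
      (by rw [hr, hb]; exact (hS _ h₂).mem)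
    exact ⟨q (), l, hq (), hl, by simpa using h⟩
  have hmemd : ∀ (a b : Fin 2 → MvPolynomial σ k) (q : MvPolynomial σ k)
      (l : Fin 2 → Fin 2 → MvPolynomial σ k), (∀ i, a i ∈ W) → (∀ i, b i ∈ W) →
      (∀ i j, (l i j).IsHomogeneous 1) → f = d * q + ∑ i, ∑ j, a i * b j * l i j →
      ∀ P ∈ S, d ∈ P →
        P ≤ W ⊔ Submodule.span k (Set.range fun p : Fin 2 × Fin 2 => l p.1 p.2) := by
    intro a b q l ha hb hl hfl P hP hdP
    refine (hS P hP).le_of_add_mem_adjoin (D := Submodule.span k {d}) hf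
      (sup_le hW1 ?_) (by simpa using hdP) ?_ ?_ ?_ hfl
    · rw [Submodule.span_le, Set.range_subset_iff]
      exact fun p => hl _ _
    · simpa using Submodule.mem_sup_left hdW
    · exact Ideal.mul_mem_right _ _ (Ideal.subset_span (Submodule.mem_span_singleton_self d))
    · exact Subalgebra.sum_mem _ fun i _ => Subalgebra.sum_mem _ fun j _ =>
        Subalgebra.mul_mem _ (Subalgebra.mul_mem _
          (Algebra.subset_adjoin (Submodule.mem_sup_left (ha i)))
          (Algebra.subset_adjoin (Submodule.mem_sup_left (hb j))))
          (Algebra.subset_adjoin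
            (Submodule.mem_sup_right (Submodule.subset_span ⟨(i, j), rfl⟩)))
  have hfinal : ∀ (l : Fin 2 → Fin 2 → MvPolynomial σ k) (z : Fin 2 → MvPolynomial σ k),
      (∀ P ∈ S, d ∈ P →
        P ≤ W ⊔ Submodule.span k (Set.range fun p : Fin 2 × Fin 2 => l p.1 p.2)) →
      (∀ P ∈ S, d ∉ P → P ≤ W ⊔ Submodule.span k (Set.range z)) →
      ∃ N : Submodule k (MvPolynomial σ k), FiniteDimensional k N ∧ finrank k N ≤ 12 ∧
        ∀ P ∈ S, P ≤ N := by
    intro l z hl hz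
    set L := Submodule.span k (Set.range fun p : Fin 2 × Fin 2 => l p.1 p.2) with hL
    set Z := Submodule.span k (Set.range z) with hZ
    have hfdL : FiniteDimensional k L := FiniteDimensional.span_of_finite k (Set.finite_range _)
    have hfdZ : FiniteDimensional k Z := FiniteDimensional.span_of_finite k (Set.finite_range _)
    refine ⟨W ⊔ L ⊔ Z, inferInstance, ?_, fun P hP => ?_⟩
    · have e1 := Submodule.finrank_add_le_finrank_add_finrank (W ⊔ L) Z
      have e2 := Submodule.finrank_add_le_finrank_add_finrank W L
      have e3 := finrank_range_le_card (R := k) fun p : Fin 2 × Fin 2 => l p.1 p.2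
      have e4 := finrank_range_le_card (R := k) z
      simp only [Set.finrank, Fintype.card_prod, Fintype.card_fin] at e3 e4
      rw [← hL] at e3
      rw [← hZ] at e4
      omega
    · by_cases hdP : d ∈ P
      · exact (hl P hP hdP).trans le_sup_left
      · exact (hz P hP hdP).trans (sup_le_sup_right le_sup_left Z)
  have hcomplete : ∀ P ∈ S, d ∈ P → ∀ P' : Submodule k (MvPolynomial σ k), d ∉ P' →
      ∀ α ∈ P' ⊓ P, α ≠ 0 → ∃ a : Fin 2 → MvPolynomial σ k, a 0 = α ∧
        Submodule.span k {d} ⊔ Submodule.span k (Set.range a) = P := by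
    intro P hP hdP P' hdP' α hα hα0
    refine Submodule.exists_span_sup_span_eq (hS _ hP).finrank_eq hdP hα.2 hd0 fun h => hα0 ?_
    exact Submodule.disjoint_def.1 (Submodule.disjoint_span_singleton_of_notMem hdP') α hα.1 h
  have hspanW : ∀ {a b : Fin 2 → MvPolynomial σ k},
      Submodule.span k {d} ⊔ Submodule.span k (Set.range a) = P₁ →
      Submodule.span k {d} ⊔ Submodule.span k (Set.range b) = P₂ →
      (∀ i, a i ∈ W) ∧ (∀ i, b i ∈ W) ∧
      W = Submodule.span k (Set.range ![d, a 0, a 1, b 0, b 1]) := by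
    intro a b ha hb
    have haW : ∀ i, a i ∈ W := fun i => Submodule.mem_sup_left
      (ha ▸ Submodule.mem_sup_right (Submodule.subset_span ⟨i, rfl⟩))
    have hbW : ∀ i, b i ∈ W := fun i => Submodule.mem_sup_right
      (hb ▸ Submodule.mem_sup_right (Submodule.subset_span ⟨i, rfl⟩))
    refine ⟨haW, hbW, le_antisymm ?_ ?_⟩
    · have hs : ∀ i, ![d, a 0, a 1, b 0, b 1] i ∈
          Submodule.span k (Set.range ![d, a 0, a 1, b 0, b 1]) :=
        fun i => Submodule.subset_span ⟨i, rfl⟩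
      rw [hW, ← ha, ← hb, sup_le_iff, sup_le_iff, sup_le_iff, Submodule.span_le,
        Submodule.span_le, Submodule.span_le, Set.singleton_subset_iff, Set.range_subset_iff,
        Set.range_subset_iff]
      refine ⟨⟨hs 0, fun i => ?_⟩, hs 0, fun i => ?_⟩ <;> fin_cases i
      exacts [hs 1, hs 2, hs 3, hs 4]
    · rw [Submodule.span_le, Set.range_subset_iff]
      intro i
      fin_cases i
      exacts [hdW, haW 0, haW 1, hbW 0, hbW 1]
  by_cases hall : ∀ P ∈ S, d ∉ P → P ≤ W
  · obtain ⟨α, hα, hαd⟩ : ∃ α ∈ P₁, α ∉ Submodule.span k {d} := by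
      by_contra! h
      have := Submodule.finrank_mono (h : P₁ ≤ _)
      rw [finrank_span_singleton hd0, (hS _ h₁).finrank_eq] at this
      omega
    obtain ⟨β, hβ, hβd⟩ : ∃ α ∈ P₂, α ∉ Submodule.span k {d} := by
      by_contra! h
      have := Submodule.finrank_mono (h : P₂ ≤ _)
      rw [finrank_span_singleton hd0, (hS _ h₂).finrank_eq] at this
      omega
    obtain ⟨a, -, ha⟩ :=
      Submodule.exists_span_sup_span_eq (hS _ h₁).finrank_eq hd.1 hα hd0 hαd
    obtain ⟨b, -, hb⟩ :=
      Submodule.exists_span_sup_span_eq (hS _ h₂).finrank_eq hd.2 hβ hd0 hβd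
    obtain ⟨q, l, hq, hl, hfl⟩ := hdecomp a b ha hb
    obtain ⟨haW, hbW, -⟩ := hspanW ha hb
    exact hfinal l 0 (hmemd a b q l haW hbW hl hfl)
      fun P hP hdP => (hall P hP hdP).trans le_sup_left
  push Not at hall
  obtain ⟨P₀, hP₀, hdP₀, hP₀W⟩ := hall
  have hfd₀ := (hS _ hP₀).finiteDimensional
  obtain ⟨α, hα, hα0⟩ := Submodule.exists_mem_ne_zero_of_ne_bot
    fun h => hnd _ hP₀ _ h₁ (disjoint_iff.2 h)
  obtain ⟨β, hβ, hβ0⟩ := Submodule.exists_mem_ne_zero_of_ne_bot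
    fun h => hnd _ hP₀ _ h₂ (disjoint_iff.2 h)
  obtain ⟨a, ha0, ha⟩ := hcomplete _ h₁ hd.1 _ hdP₀ α hα hα0
  obtain ⟨b, hb0, hb⟩ := hcomplete _ h₂ hd.2 _ hdP₀ β hβ hβ0
  obtain ⟨q, l, hq, hl, hfl⟩ := hdecomp a b ha hb
  obtain ⟨haW, hbW, hWspan⟩ := hspanW ha hb
  by_cases hqW : q ∈ Ideal.span (W : Set (MvPolynomial σ k))
  · have h6 : finrank k (P₀ ⊔ W : Submodule k (MvPolynomial σ k)) = 6 := by
      have e1 := hsup _ hP₀ hdP₀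
      have e2 := Submodule.finrank_lt_finrank_of_lt (right_lt_sup.2 hP₀W)
      omega
    obtain ⟨N, hN, hN12, hSN⟩ := exists_finrank_le_twelve_of_mem_span hf hW1 (hS _ hP₀)
      (ha0 ▸ hα.1) (hb0 ▸ hβ.1) hWspan hq hqW hl hfl h6
    exact ⟨N, hN, hN12, fun P hP => hSN P (hS P hP)⟩
  have hz : ∀ P ∈ S, d ∉ P → ∀ z ∈ P, z ∉ W →
      z.IsHomogeneous 1 ∧
      q ∈ Ideal.span ((W ⊔ Submodule.span k {z} : Submodule k (MvPolynomial σ k)) :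
        Set (MvPolynomial σ k)) := by
    intro P hP hdP z hzP hzW
    have := (hS _ hP).finiteDimensional
    have e1 : W ⊔ Submodule.span k {z} = P ⊔ W := by
      refine Submodule.eq_of_le_of_finrank_le
        (sup_le le_sup_right (by simpa using Submodule.mem_sup_left hzP)) ?_
      have e2 := Submodule.finrank_lt_finrank_of_lt
        (left_lt_sup.2 (by simpa using hzW) : W < W ⊔ Submodule.span k {z})
      have e3 := hsup _ hP hdP
      omega
    refine ⟨(hS _ hP).le hzP, ?_⟩
    rw [e1, sup_comm]
    refine mem_span_sup_of_mul_add_mem (ι := Fin 2 × Fin 2) (d := d) (x := fun p => a p.1)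
      (y := fun p => b p.2) (l := fun p => l p.1 p.2) (hS _ hP).le hW1 hdW hdP
      (fun p => haW p.1) (fun p => hbW p.2) ?_
    have h := (hS _ hP).mem
    rwa [hfl, ← Fintype.sum_prod_type'] at h
  obtain ⟨z₁, hz₁P, hz₁W⟩ := SetLike.not_le_iff_exists.1 hP₀W
  obtain ⟨hz₁h, hqz₁⟩ := hz P₀ hP₀ hdP₀ z₁ hz₁P hz₁W
  by_cases hall₁ : ∀ P ∈ S, d ∉ P → P ≤ W ⊔ Submodule.span k {z₁}
  · exact hfinal l (fun _ => z₁) (hmemd a b q l haW hbW hl hfl) fun P hP hdP => by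
      simpa using hall₁ P hP hdP
  push Not at hall₁
  obtain ⟨P', hP', hdP', hP'W⟩ := hall₁
  obtain ⟨z₂, hz₂P, hz₂W⟩ := SetLike.not_le_iff_exists.1 hP'W
  obtain ⟨hz₂h, hqz₂⟩ := hz P' hP' hdP' z₂ hz₂P fun h => hz₂W (Submodule.mem_sup_left h)
  refine hfinal l ![z₁, z₂] (hmemd a b q l haW hbW hl hfl) fun P hP hdP => ?_
  rw [Matrix.range_cons, Matrix.range_cons, Matrix.range_empty, Set.union_empty,
    Submodule.span_union, ← sup_assoc]
  intro z₃ hz₃P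
  by_contra hz₃W
  obtain ⟨hz₃h, hqz₃⟩ := hz P hP hdP z₃ hz₃P fun h =>
    hz₃W (Submodule.mem_sup_left (Submodule.mem_sup_left h))
  exact hqW (mem_span_of_mem_span_sup_singleton hW1 hq hz₁h hz₂h hz₃h hz₁W hz₂W hz₃W
    hqz₁ hqz₂ hqz₃)

end MeetingInALine

section SliceRank

variable {k σ : Type*} [Field k]

theorem exists_finrank_le_twelve_of_finrank_inf_eq_two {f : MvPolynomial σ k}
    (hf3 : f.IsHomogeneous 3) (hf : SliceRankGEThree f)
    {S : Set (Submodule k (MvPolynomial σ k))} (hS : ∀ P ∈ S, IsSliceSpace f P)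
    (h2 : ∀ P ∈ S, ∀ P' ∈ S, 2 ≤ finrank k (P ⊓ P' : Submodule k (MvPolynomial σ k)))
    {P₁ P₂ : Submodule k (MvPolynomial σ k)} (h₁ : P₁ ∈ S) (h₂ : P₂ ∈ S) (hne : P₁ ≠ P₂) :
    ∃ N : Submodule k (MvPolynomial σ k), FiniteDimensional k N ∧ finrank k N ≤ 12 ∧
      ∀ P ∈ S, P ≤ N := by
  have hfd₁ := (hS _ h₁).finiteDimensional
  have hfd₂ := (hS _ h₂).finiteDimensional
  have hnle : ¬ P₂ ≤ P₁ := fun h => hne (Submodule.eq_of_le_of_finrank_le h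
    (by rw [(hS _ h₁).finrank_eq, (hS _ h₂).finrank_eq])).symm
  have hnle' : ¬ P₁ ≤ P₂ := fun h => hne (Submodule.eq_of_le_of_finrank_le h
    (by rw [(hS _ h₁).finrank_eq, (hS _ h₂).finrank_eq]))
  have hD2 : finrank k (P₁ ⊓ P₂ : Submodule k (MvPolynomial σ k)) = 2 := by
    have e1 := h2 _ h₁ _ h₂
    have e2 := Submodule.finrank_lt_finrank_of_lt (inf_lt_left.2 hnle')
    rw [(hS _ h₁).finrank_eq] at e2
    omega
  obtain ⟨a, ha, ha'⟩ := SetLike.not_le_iff_exists.1 hnle'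
  obtain ⟨b, hb, hb'⟩ := SetLike.not_le_iff_exists.1 hnle
  set D := P₁ ⊓ P₂ with hD
  have hspan : ∀ P ∈ S, D ≤ P → ∀ v ∈ P, v ∉ D → D ⊔ Submodule.span k {v} = P := by
    intro P hP hDP v hv hvD
    have := (hS _ hP).finiteDimensional
    refine Submodule.eq_of_le_of_finrank_le (sup_le hDP (by simpa using hv)) ?_
    have := Submodule.finrank_lt_finrank_of_lt
      (left_lt_sup.2 (by simpa using hvD) : D < D ⊔ Submodule.span k {v})
    rw [(hS _ hP).finrank_eq]
    omega
  have hDa := hspan _ h₁ inf_le_left a ha fun h => ha' h.2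
  have hDb := hspan _ h₂ inf_le_right b hb fun h => hb' h.1
  obtain ⟨w, hw⟩ := Submodule.exists_span_range_eq D rfl
  have hwD : ∀ i, w i ∈ D := fun i => hw ▸ Submodule.subset_span ⟨i, rfl⟩
  have hr : ∀ z : MvPolynomial σ k, Set.range (fun _ : Unit => z) = {z} := fun z => by simp
  obtain ⟨q, l, -, hl, hfl⟩ := exists_eq_sum_add_sum_of_mem_span (n := 1) (f := f) (d := w)
    (a := fun _ : Unit => a) (b := fun _ : Unit => b) (fun i => (hS _ h₁).le (hwD i).1)
    (fun _ => (hS _ h₁).le ha) (fun _ => (hS _ h₂).le hb)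
    (by
      rw [hw, hr, hr, hDa]
      exact Submodule.disjoint_span_singleton_of_notMem hb')
    hf3 (by rw [hw, hr, hDa]; exact (hS _ h₁).mem) (by rw [hw, hr, hDb]; exact (hS _ h₂).mem)
  simp only [Finset.univ_unique, Finset.sum_singleton] at hfl
  set c := l default default
  refine ⟨P₁ ⊔ P₂ ⊔ Submodule.span k {c}, inferInstance, ?_, fun P hP => ?_⟩
  · have e1 := Submodule.finrank_add_le_finrank_add_finrank (P₁ ⊔ P₂) (Submodule.span k {c})
    have e2 := Submodule.finrank_add_le_finrank_add_finrank P₁ P₂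
    have e3 := finrank_span_le_card (R := k) ({c} : Set (MvPolynomial σ k))
    simp only [Set.toFinset_singleton, Finset.card_singleton] at e3
    rw [(hS _ h₁).finrank_eq, (hS _ h₂).finrank_eq] at e2
    omega
  have hfdP := (hS _ hP).finiteDimensional
  by_cases hDP : D ≤ P
  · refine (hS P hP).le_of_add_mem_adjoin (D := D) hf (sup_le
      (sup_le (hS _ h₁).le (hS _ h₂).le) (by simpa using hl _ _)) hDP
      (inf_le_left.trans (le_sup_left.trans le_sup_left)) ?_ ?_ hfl
    · exact Ideal.sum_mem _ fun i _ => Ideal.mul_mem_right _ _ (Ideal.subset_span (hwD i))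
    · refine Subalgebra.mul_mem _ (Subalgebra.mul_mem _ ?_ ?_) ?_ <;>
        refine Algebra.subset_adjoin ?_
      · exact Submodule.mem_sup_left (Submodule.mem_sup_left ha)
      · exact Submodule.mem_sup_left (Submodule.mem_sup_right hb)
      · exact Submodule.mem_sup_right (Submodule.mem_span_singleton_self c)
  · refine le_trans ?_ (le_sup_left : P₁ ⊔ P₂ ≤ _)
    have e1 := h2 _ hP _ h₁
    have e2 := h2 _ hP _ h₂
    have e3 := Submodule.finrank_sup_add_finrank_inf_eq (P ⊓ P₁) (P ⊓ P₂)
    rw [← inf_inf_distrib_left, ← hD] at e3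
    have e4 := Submodule.finrank_lt_finrank_of_lt (inf_lt_right.2 hDP)
    have e5 : (P ⊓ P₁) ⊔ (P ⊓ P₂) = P := by
      refine Submodule.eq_of_le_of_finrank_le (sup_le inf_le_left inf_le_left) ?_
      rw [(hS _ hP).finrank_eq]
      omega
    calc P = (P ⊓ P₁) ⊔ (P ⊓ P₂) := e5.symm
      _ ≤ P₁ ⊔ P₂ := sup_le_sup inf_le_right inf_le_right

theorem exists_finrank_le_twelve {f : MvPolynomial σ k} (hf3 : f.IsHomogeneous 3)
    (hf : SliceRankGEThree f) {S : Set (Submodule k (MvPolynomial σ k))}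
    (hS : ∀ P ∈ S, IsSliceSpace f P) :
    ∃ N : Submodule k (MvPolynomial σ k), FiniteDimensional k N ∧ finrank k N ≤ 12 ∧
      ∀ P ∈ S, P ≤ N := by
  by_cases hdis : ∃ P ∈ S, ∃ P' ∈ S, Disjoint P P'
  · obtain ⟨P, hP, P', hP', h⟩ := hdis
    exact exists_finrank_le_twelve_of_disjoint hf3 hf hS hP hP' h
  push Not at hdis
  by_cases hone : ∃ P ∈ S, ∃ P' ∈ S, finrank k (P ⊓ P' : Submodule k (MvPolynomial σ k)) = 1
  · obtain ⟨P, hP, P', hP', h⟩ := hone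
    exact exists_finrank_le_twelve_of_finrank_inf_eq_one hf3 hf hS hdis hP hP' h
  push Not at hone
  have h2 : ∀ P ∈ S, ∀ P' ∈ S, 2 ≤ finrank k (P ⊓ P' : Submodule k (MvPolynomial σ k)) := by
    intro P hP P' hP'
    have := (hS _ hP).finiteDimensional
    have h1 : 1 ≤ finrank k (P ⊓ P' : Submodule k (MvPolynomial σ k)) :=
      Submodule.one_le_finrank_iff.2 fun h => hdis P hP P' hP' (disjoint_iff.2 h)
    have := hone P hP P' hP'
    omega
  by_cases hne : ∃ P ∈ S, ∃ P' ∈ S, P ≠ P'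
  · obtain ⟨P, hP, P', hP', h⟩ := hne
    exact exists_finrank_le_twelve_of_finrank_inf_eq_two hf3 hf hS h2 hP hP' h
  push Not at hne
  rcases S.eq_empty_or_nonempty with rfl | ⟨P, hP⟩
  · exact ⟨⊥, inferInstance, by simp, by simp⟩
  · exact ⟨P, (hS _ hP).finiteDimensional, by rw [(hS _ hP).finrank_eq]; norm_num,
      fun P' hP' => (hne P' hP' P hP).le⟩

theorem sliceRank_le_finrank {f : MvPolynomial σ k} {Q : Submodule k (MvPolynomial σ k)}
    [FiniteDimensional k Q] (hQ : Q ≤ homogeneousSubmodule σ k 1)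
    (hf : f ∈ Ideal.span (Q : Set (MvPolynomial σ k))) : sliceRank f ≤ finrank k Q := by
  obtain ⟨a, ha⟩ := Submodule.exists_span_range_eq Q rfl
  refine Nat.sInf_le ⟨a, fun i => hQ (ha ▸ Submodule.subset_span ⟨i, rfl⟩), ?_⟩
  rwa [← Ideal.span_coe_span_eq, ha]

theorem finrank_Lspace_le_twelve {f : MvPolynomial σ k} (hf3 : f.IsHomogeneous 3)
    (hf : sliceRank f = 3) : finrank k (Lspace f) ≤ 12 := by
  obtain ⟨N, hN, hN12, hle⟩ := exists_finrank_le_twelve hf3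
    (fun Q hQ _ hfQ => hf ▸ sliceRank_le_finrank hQ hfQ) (S := slicePlanes f)
    fun P hP => ⟨hP.1, hf ▸ hP.2.1, hP.2.2⟩
  exact (Submodule.finrank_mono (sSup_le hle)).trans hN12

end SliceRank

section TestCubic

variable {k : Type*} [Field k]

theorem testCubic4_isHomogeneous : (testCubic4 k).IsHomogeneous 3 :=
  IsHomogeneous.sum _ _ _ fun _ _ =>
    ((isHomogeneous_X k _).mul (isHomogeneous_X k _)).mul (isHomogeneous_X k _)

theorem sliceRankGEThree_testCubic4 : SliceRankGEThree (testCubic4 k) := by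
  intro Q hQ _ hf
  by_contra! hlt
  set x : Fin 4 → MvPolynomial TestVars4 k := X ∘ Sum.inl with hx
  set y : {p : Fin 4 × Fin 4 // p.1 < p.2} → MvPolynomial TestVars4 k := X ∘ Sum.inr with hy
  obtain ⟨hlx, hly, hdis⟩ := linearIndependent_sum.1 (linearIndependent_X TestVars4 k)
  set W := Submodule.span k (Set.range x) with hW
  have hfdW : FiniteDimensional k W := FiniteDimensional.span_of_finite k (Set.finite_range x)
  have hxW : ∀ i, x i ∈ W := fun i => Submodule.subset_span ⟨i, rfl⟩
  have hW1 : W ≤ homogeneousSubmodule TestVars4 k 1 :=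
    Submodule.span_le.2 (Set.range_subset_iff.2 fun i => isHomogeneous_X k _)
  have hW4 : finrank k W = 4 := by simpa using finrank_span_eq_card hlx
  set A := evalAnnihilator Q x with hA
  have hQW : finrank k (Q ⊔ W : Submodule k (MvPolynomial TestVars4 k)) ≤
      finrank k Q + finrank k A := finrank_sup_span_le_add_finrank_evalAnnihilator Q x
  have hWQW := Submodule.finrank_mono (le_sup_right : W ≤ Q ⊔ W)
  have hquad : ∀ u ∈ A, ∑ p : {p : Fin 4 × Fin 4 // p.1 < p.2}, (u p.1.1 * u p.1.2) • y p ∈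
      Q ⊔ W := by
    intro u hu
    obtain ⟨η, hη, hηu⟩ := mem_evalAnnihilator.1 hu
    have := sum_smul_mem_of_mem_span hQ hW1
      (x := fun p : {p : Fin 4 × Fin 4 // p.1 < p.2} => x p.1.1) (y := fun p => x p.1.2)
      (l := y) (fun p => hxW _) (fun p => hxW _) (fun p => isHomogeneous_X k _) hf hη
    simpa only [hηu] using this
  obtain ⟨u, huA, hu0⟩ := Submodule.exists_mem_ne_zero_of_ne_bot (p := A) fun h => by
    rw [h, finrank_bot] at hQW
    omega
  obtain ⟨i, hi⟩ : ∃ i, u i ≠ 0 := Function.ne_iff.1 hu0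
  set L : (Fin 4 → k) →ₗ[k] MvPolynomial TestVars4 k :=
    ∑ p : {p : Fin 4 × Fin 4 // p.1 < p.2},
      (u p.1.1 • LinearMap.proj p.1.2 + u p.1.2 • LinearMap.proj p.1.1 :
        (Fin 4 → k) →ₗ[k] k).smulRight (y p) with hL
  have hLapp : ∀ v, L v = ∑ p : {p : Fin 4 × Fin 4 // p.1 < p.2},
      (u p.1.1 * v p.1.2 + u p.1.2 * v p.1.1) • y p := by
    intro v
    simp [hL, LinearMap.sum_apply]
  have hmap : A.map L ≤ Q ⊔ W := by
    rintro _ ⟨v, hv, rfl⟩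
    have h := Submodule.sub_mem _ (Submodule.sub_mem _ (hquad _ (A.add_mem huA hv))
      (hquad _ huA)) (hquad _ hv)
    rw [← Finset.sum_sub_distrib, ← Finset.sum_sub_distrib] at h
    rw [hLapp]
    convert h using 2 with p
    rw [← sub_smul, ← sub_smul, Pi.add_apply, Pi.add_apply]
    congr 1
    ring
  have hker : finrank k (LinearMap.ker (L.domRestrict A)) ≤ 1 := by
    have hinj : Function.Injective (((LinearMap.proj i : (Fin 4 → k) →ₗ[k] k) ∘ₗ A.subtype) ∘ₗ
        (LinearMap.ker (L.domRestrict A)).subtype) := by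
      rw [injective_iff_map_eq_zero]
      rintro ⟨⟨v, hvA⟩, hv⟩ hvi
      have hvi : v i = 0 := hvi
      have hv : L v = 0 := hv
      rw [hLapp] at hv
      have hcoef := Fintype.linearIndependent_iff.1 hly _ hv
      suffices h : v = 0 by
        ext : 2
        exact h
      ext j
      rcases lt_trichotomy i j with hij | rfl | hij
      · have := hcoef ⟨(i, j), hij⟩
        simpa [hvi, hi] using this
      · exact hvi
      · have := hcoef ⟨(j, i), hij⟩
        simpa [hvi, hi] using this
    simpa using LinearMap.finrank_le_finrank_of_injective hinj
  have hrn := LinearMap.finrank_range_add_finrank_ker (L.domRestrict A)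
  rw [LinearMap.range_domRestrict] at hrn
  have hdisj : W ⊓ A.map L = ⊥ := by
    refine disjoint_iff.1 (hdis.mono_right ?_)
    rintro _ ⟨v, -, rfl⟩
    rw [hLapp]
    exact Submodule.sum_mem _ fun p _ =>
      Submodule.smul_mem _ _ (Submodule.subset_span ⟨p, rfl⟩)
  have hsum := Submodule.finrank_sup_add_finrank_inf_eq W (A.map L)
  rw [hdisj, finrank_bot] at hsum
  have hle := Submodule.finrank_mono (sup_le le_sup_right hmap : W ⊔ A.map L ≤ Q ⊔ W)
  omega

/-- The span of `y_p` and of the two variables `x_i`, `x_j` with `i`, `j` not in the pair `p`. -/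
noncomputable def testPlane (k : Type*) [Field k] (p : {p : Fin 4 × Fin 4 // p.1 < p.2})
    (i j : Fin 4) : Submodule k (MvPolynomial TestVars4 k) :=
  Submodule.span k (Set.range (X ∘ ![Sum.inr p, Sum.inl i, Sum.inl j]))

theorem isSliceSpace_testPlane {p : {p : Fin 4 × Fin 4 // p.1 < p.2}} {i j : Fin 4} (hij : i ≠ j)
    (hq : ∀ q : {p : Fin 4 × Fin 4 // p.1 < p.2},
      q = p ∨ q.1.1 = i ∨ q.1.1 = j ∨ q.1.2 = i ∨ q.1.2 = j) :
    IsSliceSpace (testCubic4 k) (testPlane k p i j) := by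
  refine ⟨Submodule.span_le.2 (Set.range_subset_iff.2 fun i => isHomogeneous_X k _), ?_, ?_⟩
  · have hinj : Function.Injective ![(Sum.inr p : TestVars4), Sum.inl i, Sum.inl j] := by
      intro a b
      fin_cases a <;> fin_cases b <;> simp [hij, hij.symm]
    have := finrank_span_eq_card ((linearIndependent_X TestVars4 k).comp _ hinj)
    rwa [Fintype.card_fin] at this
  · have hmem : ∀ a, X (![Sum.inr p, Sum.inl i, Sum.inl j] a) ∈
        Ideal.span (testPlane k p i j : Set (MvPolynomial TestVars4 k)) :=
      fun a => Ideal.subset_span (Submodule.subset_span ⟨a, rfl⟩)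
    refine Ideal.sum_mem _ fun q _ => ?_
    rcases hq q with rfl | h | h | h | h
    · exact Ideal.mul_mem_left _ _ (hmem 0)
    · exact Ideal.mul_mem_right _ _ (Ideal.mul_mem_right _ _ (h ▸ hmem 1))
    · exact Ideal.mul_mem_right _ _ (Ideal.mul_mem_right _ _ (h ▸ hmem 2))
    · exact Ideal.mul_mem_right _ _ (Ideal.mul_mem_left _ _ (h ▸ hmem 1))
    · exact Ideal.mul_mem_right _ _ (Ideal.mul_mem_left _ _ (h ▸ hmem 2))

theorem SliceRankGEThree.sliceRank_eq_three {σ : Type*} {f : MvPolynomial σ k}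
    (hf : SliceRankGEThree f) {P : Submodule k (MvPolynomial σ k)} (hP : IsSliceSpace f P) :
    sliceRank f = 3 := by
  have := hP.finiteDimensional
  refine le_antisymm (hP.finrank_eq ▸ sliceRank_le_finrank hP.le hP.mem) ?_
  refine le_csInf ?_ ?_
  · obtain ⟨a, ha⟩ := Submodule.exists_span_range_eq P hP.finrank_eq
    refine ⟨3, a, fun i => hP.le (ha ▸ Submodule.subset_span ⟨i, rfl⟩), ?_⟩
    rw [← Ideal.span_coe_span_eq, ha]
    exact hP.mem
  · rintro r ⟨ℓ, hℓ, hfℓ⟩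
    have h := hf (Submodule.span k (Set.range ℓ))
      (Submodule.span_le.2 (Set.range_subset_iff.2 hℓ))
      (FiniteDimensional.span_of_finite k (Set.finite_range ℓ))
      (by rwa [Ideal.span_coe_span_eq])
    have h' := finrank_range_le_card (R := k) ℓ
    rw [Fintype.card_fin] at h'
    exact h.trans h'

theorem sliceRank_testCubic4 : sliceRank (testCubic4 k) = 3 :=
  sliceRankGEThree_testCubic4.sliceRank_eq_three
    (isSliceSpace_testPlane (p := ⟨(0, 1), by decide⟩) (i := 2) (j := 3) (by decide) (by decide))

theorem finrank_Lspace_testCubic4 : finrank k (Lspace (testCubic4 k)) = 10 := by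
  have hplane : ∀ {p i j}, i ≠ j → (∀ q : {p : Fin 4 × Fin 4 // p.1 < p.2},
      q = p ∨ q.1.1 = i ∨ q.1.1 = j ∨ q.1.2 = i ∨ q.1.2 = j) →
      testPlane k p i j ≤ Lspace (testCubic4 k) := by
    intro p i j hij hq
    have h := isSliceSpace_testPlane (k := k) hij hq
    exact le_sSup ⟨h.le, h.finrank_eq.trans sliceRank_testCubic4.symm, h.mem⟩
  have hcover : ∀ v : TestVars4, X v ∈ Lspace (testCubic4 k) := by
    rintro (i | p)
    · obtain ⟨p, j, hij, hq⟩ : ∃ (p : {p : Fin 4 × Fin 4 // p.1 < p.2}) (j : Fin 4), i ≠ j ∧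
          ∀ q : {p : Fin 4 × Fin 4 // p.1 < p.2},
            q = p ∨ q.1.1 = i ∨ q.1.1 = j ∨ q.1.2 = i ∨ q.1.2 = j := by
        revert i
        decide
      exact hplane hij hq (Submodule.subset_span ⟨1, rfl⟩)
    · obtain ⟨i, j, hij, hq⟩ : ∃ i j : Fin 4, i ≠ j ∧
          ∀ q : {p : Fin 4 × Fin 4 // p.1 < p.2},
            q = p ∨ q.1.1 = i ∨ q.1.1 = j ∨ q.1.2 = i ∨ q.1.2 = j := by
        revert p
        decide
      exact hplane hij hq (Submodule.subset_span ⟨0, rfl⟩)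
  have heq : Lspace (testCubic4 k) =
      Submodule.span k (Set.range (X : TestVars4 → MvPolynomial TestVars4 k)) := by
    refine le_antisymm ?_ (Submodule.span_le.2 (Set.range_subset_iff.2 hcover))
    rw [← homogeneousSubmodule_one_eq_span_X]
    exact sSup_le fun P hP => hP.1
  rw [heq, finrank_span_eq_card (linearIndependent_X TestVars4 k)]
  decide

end TestCubic

/-- The cubic `f_4 = Σ_{i<j} x_i x_j y_{ij}` is homogeneous of degree 3,
has slice rank `3` and satisfies `dim L_{f_4} = 10`; moreover every homogeneous cubic `g`
of slice rank `3` satisfies `dim L_g ≤ 12`. Hence `10 ≤ c(3) ≤ 12`. -/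
theorem ten_le_c_three_le_twelve {k : Type*} [Field k] :
    ((testCubic4 k).IsHomogeneous 3 ∧ sliceRank (testCubic4 k) = 3 ∧
      Module.finrank k (Lspace (testCubic4 k)) = 10) ∧
    ∀ (n : ℕ) (g : MvPolynomial (Fin n) k), g.IsHomogeneous 3 → sliceRank g = 3 →
      Module.finrank k (Lspace g) ≤ 12 := by
  exact ⟨⟨testCubic4_isHomogeneous, sliceRank_testCubic4, finrank_Lspace_testCubic4⟩,
    fun _ _ hg hg3 => finrank_Lspace_le_twelve hg hg3⟩
end

section
/- Let k be a field, n ≥ 2, and f_n = Σ_{1 ≤ i < j ≤ n} x_i x_j y_{ij} in the polynomial ring k[x_i, y_{jk}]. Every irreducible component Z of the singular locus of the hypersurface f_n = 0 (the common vanishing locus of all partial derivatives of f_n) other than the linear subspace V(x_1,...,x_n) is contained in a linear subspace of codimension 2n−2; more precisely, if x_i does not vanish identically on Z for some i, then x_j and y_{ij} vanish on Z for all j ≠ i. -/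
open MvPolynomial

/-- The variables `x_1, …, x_n` together with `y_{ij}` for `1 ≤ i < j ≤ n`. -/
abbrev TestVars (n : ℕ) := Fin n ⊕ {p : Fin n × Fin n // p.1 < p.2}

/-- The variable `y_{ij}`, with the convention `y_{ji} = y_{ij}` (junk value if `i = j`). -/
def yVar {n : ℕ} (i j : Fin n) : TestVars n :=
  if h : i < j then Sum.inr ⟨(i, j), h⟩
  else if h' : j < i then Sum.inr ⟨(j, i), h'⟩
  else Sum.inl i

/-- The cubic `f_n = Σ_{i<j} x_i x_j y_{ij}`. -/
noncomputable def testCubic (k : Type*) [Field k] (n : ℕ) : MvPolynomial (TestVars n) k :=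
  ∑ p : {p : Fin n × Fin n // p.1 < p.2},
    X (Sum.inl p.1.1) * X (Sum.inl p.1.2) * X (Sum.inr p)

/-- The singular locus of the hypersurface `f_n = 0`: the common vanishing locus of all
first-order partial derivatives of `f_n`. -/
def singularLocus (k : Type*) [Field k] (n : ℕ) : Set (TestVars n → k) :=
  {p | ∀ v : TestVars n, eval p (pderiv v (testCubic k n)) = 0}

/-- Zariski-closed subsets of affine space: common vanishing loci of sets of polynomials. -/
def IsZarClosed {k : Type*} [Field k] {σ : Type*} (Z : Set (σ → k)) : Prop :=
  ∃ T : Set (MvPolynomial σ k), Z = {p | ∀ g ∈ T, eval p g = 0}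

theorem isZarClosed_coordinate {k : Type*} [Field k] {σ : Type*} (v : σ) :
    IsZarClosed {p : σ → k | p v = 0} :=
  ⟨{X v}, by simp⟩

/-- An irreducible set on which the product of two coordinates vanishes and on which the first
coordinate is not identically zero lies in the zero locus of the second. -/
theorem coordinate_eq_zero_of_irreducible {k : Type*} [Field k] {σ : Type*} {Z : Set (σ → k)}
    (hZirr : ∀ A B : Set (σ → k), IsZarClosed A → IsZarClosed B → Z ⊆ A ∪ B → Z ⊆ A ∨ Z ⊆ B)
    {v w : σ} (hv : ∃ p ∈ Z, p v ≠ 0) (hvw : ∀ p ∈ Z, p v = 0 ∨ p w = 0) :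
    ∀ p ∈ Z, p w = 0 := by
  rcases hZirr _ _ (isZarClosed_coordinate v) (isZarClosed_coordinate w) hvw with h | h
  · obtain ⟨p, hp, hne⟩ := hv
    exact absurd (h hp) hne
  · exact h

theorem eval_pderiv_inr_testCubic {k : Type*} [Field k] {n : ℕ} (p : TestVars n → k)
    (q : {q : Fin n × Fin n // q.1 < q.2}) :
    eval p (pderiv (Sum.inr q) (testCubic k n)) = p (Sum.inl q.1.1) * p (Sum.inl q.1.2) := by
  rw [testCubic, map_sum, map_sum, Finset.sum_eq_single q]
  · simp [Derivation.leibniz, pderiv_X]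
  · intro r _ hr
    simp [Derivation.leibniz, pderiv_X, hr]
  · simp

theorem eval_pderiv_inl_testCubic {k : Type*} [Field k] {n : ℕ} (p : TestVars n → k)
    (j : Fin n) :
    eval p (pderiv (Sum.inl j) (testCubic k n)) =
      ∑ q : {q : Fin n × Fin n // q.1 < q.2},
        ((if q.1.1 = j then p (Sum.inl q.1.2) * p (Sum.inr q) else 0) +
          if q.1.2 = j then p (Sum.inl q.1.1) * p (Sum.inr q) else 0) := by
  rw [testCubic, map_sum, map_sum]
  refine Finset.sum_congr rfl fun q _ => ?_
  have hq : q.1.1 ≠ q.1.2 := q.2.ne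
  simp only [Derivation.leibniz, pderiv_X, Pi.single_apply, smul_eq_mul, map_add, map_mul, eval_X,
    Sum.inl.injEq, reduceCtorEq, if_false, mul_zero, map_zero]
  split_ifs <;> simp_all <;> ring

theorem mul_eq_zero_of_mem_singularLocus {k : Type*} [Field k] {n : ℕ} {p : TestVars n → k}
    (hp : p ∈ singularLocus k n) {i j : Fin n} (hij : j ≠ i) :
    p (Sum.inl i) = 0 ∨ p (Sum.inl j) = 0 := by
  rcases lt_or_gt_of_ne hij with h | h
  · have := hp (Sum.inr ⟨(j, i), h⟩)
    rw [eval_pderiv_inr_testCubic] at this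
    exact (mul_eq_zero.mp this).symm
  · have := hp (Sum.inr ⟨(i, j), h⟩)
    rw [eval_pderiv_inr_testCubic] at this
    exact mul_eq_zero.mp this

theorem eq_zero_or_yVar_eq_zero_of_mem_singularLocus {k : Type*} [Field k] {n : ℕ}
    {p : TestVars n → k} (hp : p ∈ singularLocus k n) {i j : Fin n} (hij : j ≠ i) :
    p (Sum.inl i) = 0 ∨ p (yVar i j) = 0 := by
  by_cases hi : p (Sum.inl i) = 0
  · exact Or.inl hi
  have hx : ∀ l, l ≠ i → p (Sum.inl l) = 0 := fun l hl =>
    (mul_eq_zero_of_mem_singularLocus hp hl).resolve_left hi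
  have hj := hp (Sum.inl j)
  rw [eval_pderiv_inl_testCubic] at hj
  rcases lt_or_gt_of_ne hij with h | h
  · rw [Finset.sum_eq_single ⟨(j, i), h⟩] at hj
    · simpa [yVar, h, h.not_gt, hij.symm] using hj
    · rintro ⟨⟨a, b⟩, hab⟩ - hne
      have h1 : a = j → p (Sum.inl b) = 0 := fun e => hx b (by rintro rfl; exact hne (by simp [e]))
      have h2 : b = j → p (Sum.inl a) = 0 := fun e => hx a (by
        rintro rfl; exact (e ▸ hab).not_gt h)
      simp +contextual [h1, h2]
    · simp
  · rw [Finset.sum_eq_single ⟨(i, j), h⟩] at hj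
    · simpa [yVar, h, h.not_gt, hij.symm] using hj
    · rintro ⟨⟨a, b⟩, hab⟩ - hne
      have h1 : a = j → p (Sum.inl b) = 0 := fun e => hx b (by
        rintro rfl; exact (e ▸ hab).not_gt h)
      have h2 : b = j → p (Sum.inl a) = 0 := fun e => hx a (by rintro rfl; exact hne (by simp [e]))
      simp +contextual [h1, h2]
    · simp


/-- Let `Z` be an irreducible component (more generally, any irreducible
subset) of the singular locus of `f_n = Σ_{i<j} x_i x_j y_{ij}`. If some `x_i` does not
vanish identically on `Z`, then `x_j` and `y_{ij}` vanish on `Z` for all `j ≠ i`; in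
particular such a `Z` (i.e. any component other than `V(x_1,…,x_n)`) is contained in a
linear subspace of codimension `2n − 2`. -/
theorem singular_component_in_small_subspace
    {k : Type*} [Field k] (n : ℕ) (hn : 2 ≤ n)
    (Z : Set (TestVars n → k)) (hZsing : Z ⊆ singularLocus k n)
    (hZne : Z.Nonempty)
    (hZirr : ∀ A B : Set (TestVars n → k), IsZarClosed A → IsZarClosed B →
      Z ⊆ A ∪ B → Z ⊆ A ∨ Z ⊆ B)
    (i : Fin n) (hi : ∃ p ∈ Z, p (Sum.inl i) ≠ 0) :
    ∀ j : Fin n, j ≠ i → ∀ p ∈ Z, p (Sum.inl j) = 0 ∧ p (yVar i j) = 0 := by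
  intro j hj p hp
  exact ⟨coordinate_eq_zero_of_irreducible hZirr hi
      (fun q hq => mul_eq_zero_of_mem_singularLocus (hZsing hq) hj) p hp,
    coordinate_eq_zero_of_irreducible hZirr hi
      (fun q hq => eq_zero_or_yVar_eq_zero_of_mem_singularLocus (hZsing hq) hj) p hp⟩
end
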